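/- arXiv:2312.10442 — 5 statements merged into one kernel-verified Lean document; each statement's English description precedes it below -/
import Mathlib

section
/- Assume that I_q^3 F = 0. Let (A, σ, f) be an F-algebra with anisotropic quadratic pair. If there exists an étale quadratic F-algebra K such that (A, σ, f) ⊗_F K is split and hyperbolic, then deg A ≤ 4. -/
/-!  Common definitions for formalizing results of
"Triality over fields with I³ = 0" (F. K. Bingöl, A. Quéguiner-Mathieu).

We model an algebra with quadratic pair `(A, σ, f)` by the data of the reduced trace
`T` of `A` (given together with the property `IsReducedTrace` characterising it via a
splitting field), the involution `σ`, and an element `ℓ ∈ A` with `ℓ + σ(ℓ) = 1`; the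
semi-trace is `f = f_ℓ : s ↦ T(ℓ s)`.  By [KMRT, (5.7)] every semi-trace is of this
form, so this is an equivalent description of quadratic pairs.  -/

open scoped TensorProduct
open Module

noncomputable section

namespace Triality

variable (F : Type) [CommRing F]

/-- A (finite-dimensional) central simple algebra. -/
def IsCSA (A : Type) [Ring A] [Algebra F A] : Prop :=
  Algebra.IsCentral F A ∧ IsSimpleRing A ∧ Module.Finite F A

/-- The degree of a central simple algebra: the square root of its dimension. -/
def deg (A : Type) [Ring A] [Algebra F A] : ℕ := Nat.sqrt (Module.finrank F A)

/-- Brauer equivalence of two algebras. -/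
def BrauerEquiv (A B : Type) [Ring A] [Algebra F A] [Ring B] [Algebra F B] : Prop :=
  ∃ n m : ℕ, 0 < n ∧ 0 < m ∧
    Nonempty (Matrix (Fin n) (Fin n) A ≃ₐ[F] Matrix (Fin m) (Fin m) B)

/-- An algebra is split if it is isomorphic to a matrix algebra over the base. -/
def IsSplit (A : Type) [Ring A] [Algebra F A] : Prop :=
  ∃ n : ℕ, 0 < n ∧ Nonempty (A ≃ₐ[F] Matrix (Fin n) (Fin n) F)

/-- The Schur index of a central simple algebra: the smallest degree of a central
simple algebra in its Brauer class (realised by the underlying division algebra). -/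
def schurIndex (A : Type) [Ring A] [Algebra F A] : ℕ :=
  sInf { d : ℕ | 0 < d ∧ ∃ (D : Type) (_ : Ring D) (_ : Algebra F D),
    IsCSA F D ∧ Module.finrank F D = d * d ∧ BrauerEquiv F A D }

/-- A linear involution (anti-automorphism of period 2) on an algebra. -/
def IsInvolution {A : Type} [Ring A] [Algebra F A] (σ : A →ₗ[F] A) : Prop :=
  (∀ x y : A, σ (x * y) = σ y * σ x) ∧ (∀ x : A, σ (σ x) = x)

/-- `T` is the reduced trace of the central simple algebra `A`: over some splitting field
it is given by the trace of matrices. -/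
def IsReducedTrace (A : Type) [Ring A] [Algebra F A] (T : A →ₗ[F] F) : Prop :=
  ∃ (E : Type) (_ : Field E) (_ : Algebra F E) (n : ℕ)
    (e : E ⊗[F] A ≃ₐ[E] Matrix (Fin n) (Fin n) E),
    ∀ a : A, algebraMap F E (T a) = Matrix.trace (e ((1 : E) ⊗ₜ[F] a))

/-- The submodule of symmetric elements of an involution. -/
def symSet {A : Type} [Ring A] [Algebra F A] (σ : A →ₗ[F] A) : Submodule F A :=
  LinearMap.ker (σ - LinearMap.id)

/-- A quadratic pair on a central simple algebra `A` with reduced trace `T`, encoded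
by the involution `σ` together with an element `ℓ` with `ℓ + σ(ℓ) = 1`; the semi-trace of
the pair is `f_ℓ : s ↦ T(ℓ s)` on symmetric elements. -/
def IsQuadraticPair (A : Type) [Ring A] [Algebra F A] (T : A →ₗ[F] F)
    (σ : A →ₗ[F] A) (ℓ : A) : Prop :=
  IsInvolution F σ ∧
  2 * Module.finrank F (symSet F σ) = deg F A * (deg F A + 1) ∧
  (∀ x : A, σ x = -x → T x = 0) ∧
  ℓ + σ ℓ = 1

/-- A right ideal of `A`, as a submodule over the base. -/
def IsRightIdeal (A : Type) [Ring A] [Algebra F A] (I : Submodule F A) : Prop :=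
  ∀ x ∈ I, ∀ a : A, x * a ∈ I

/-- An isotropic right ideal for the quadratic pair `(σ, f_ℓ)`:
`σ(I)·I = 0` and the semi-trace `f_ℓ = T(ℓ·)` vanishes on `I ∩ Sym(A,σ)`. -/
def IsIsotropicIdeal (A : Type) [Ring A] [Algebra F A] (T : A →ₗ[F] F)
    (σ : A →ₗ[F] A) (ℓ : A) (I : Submodule F A) : Prop :=
  IsRightIdeal F A I ∧
  (∀ x ∈ I, ∀ y ∈ I, σ x * y = 0) ∧
  (∀ x ∈ I, σ x = x → T (ℓ * x) = 0)

/-- The algebra with quadratic pair `(A, σ, f_ℓ)` is isotropic. -/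
def QPIsotropic (A : Type) [Ring A] [Algebra F A] (T : A →ₗ[F] F)
    (σ : A →ₗ[F] A) (ℓ : A) : Prop :=
  ∃ I : Submodule F A, IsIsotropicIdeal F A T σ ℓ I ∧ I ≠ ⊥

/-- The algebra with quadratic pair `(A, σ, f_ℓ)` is hyperbolic. -/
def QPHyperbolic (A : Type) [Ring A] [Algebra F A] (T : A →ₗ[F] F)
    (σ : A →ₗ[F] A) (ℓ : A) : Prop :=
  ∃ I : Submodule F A, IsIsotropicIdeal F A T σ ℓ I ∧
    2 * Module.finrank F I = Module.finrank F A

/-- The index of an algebra with quadratic pair: the set of reduced dimensions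
`dim_F I / deg A` of isotropic right ideals `I`. -/
def qpIndexSet (A : Type) [Ring A] [Algebra F A] (T : A →ₗ[F] F)
    (σ : A →ₗ[F] A) (ℓ : A) : Set ℕ :=
  { r : ℕ | ∃ I : Submodule F A, IsIsotropicIdeal F A T σ ℓ I ∧
      Module.finrank F I = r * deg F A }

/-- A symplectic involution, characterised characteristic-freely: in characteristic 2,
`1` is an alternating element; in characteristic `≠ 2`, the symmetric elements have
dimension `n(n-1)/2`. -/
def IsSymplectic (A : Type) [Ring A] [Algebra F A] (σ : A →ₗ[F] A) : Prop :=
  IsInvolution F σ ∧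
    ((ringChar F = 2 ∧ ∃ y : A, 1 = y + σ y) ∨
     (ringChar F ≠ 2 ∧ 2 * Module.finrank F (symSet F σ) = deg F A * (deg F A - 1)))

/-- The sandwich map `Sand : A ⊗ A → End_F(A)`, `Sand(a ⊗ b)(x) = a x b`. -/
def sand (A : Type) [Ring A] [Algebra F A] : A ⊗[F] A →ₗ[F] A →ₗ[F] A :=
  TensorProduct.lift
    (LinearMap.mk₂ F (fun a b => (LinearMap.mulRight F b).comp (LinearMap.mulLeft F a))
      (fun a a' b => by ext x; simp [add_mul])
      (fun c a b => by ext x; simp [smul_mul_assoc])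
      (fun a b b' => by ext x; simp [mul_add])
      (fun c a b => by ext x; simp [mul_smul_comm]))

/-- The degree-two part map `A ⊗ A → T(A)`, `a ⊗ b ↦ ι a * ι b`. -/
def mu2 (A : Type) [Ring A] [Algebra F A] : A ⊗[F] A →ₗ[F] TensorAlgebra F A :=
  TensorProduct.lift
    (LinearMap.mk₂ F (fun a b => TensorAlgebra.ι F a * TensorAlgebra.ι F b)
      (fun a a' b => by simp [add_mul])
      (fun c a b => by simp [smul_mul_assoc])
      (fun a b b' => by simp [mul_add])
      (fun c a b => by simp [mul_smul_comm]))

/-- The defining relations of the Clifford algebra `C(A, σ, f)` of an algebra with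
quadratic pair, following [KMRT, §8.B]: in the tensor algebra `T(A)`, a symmetric
element `s`, viewed in degree one, is identified with the scalar `f(s) = T(ℓ s)`, and a
`σ₂`-symmetric element `c ∈ A ⊗ A` (i.e. `Sand(c) ∘ σ = Sand(c)`), viewed in degree two,
is identified with the degree-one element `Sand(c)(ℓ)`.  (In the split case
`A = End(V)`, `(σ, f) = ad(q)`, these are the Bichsel–Knus relations presenting
the even Clifford algebra `C₀(q)`.) -/
inductive CliffordRel (A : Type) [Ring A] [Algebra F A] (T : A →ₗ[F] F)
    (σ : A →ₗ[F] A) (ℓ : A) : TensorAlgebra F A → TensorAlgebra F A → Prop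
  | sym (s : A) (hs : σ s = s) :
      CliffordRel A T σ ℓ (TensorAlgebra.ι F s) (algebraMap F _ (T (ℓ * s)))
  | deg2 (c : A ⊗[F] A) (hc : ∀ x : A, sand F A c (σ x) = sand F A c x) :
      CliffordRel A T σ ℓ (mu2 F A c) (TensorAlgebra.ι F (sand F A c ℓ))

/-- The Clifford algebra of an algebra with quadratic pair [KMRT, §8.B]. -/
def CliffordAlg (A : Type) [Ring A] [Algebra F A] (T : A →ₗ[F] F)
    (σ : A →ₗ[F] A) (ℓ : A) : Type :=
  RingQuot (CliffordRel F A T σ ℓ)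

instance (A : Type) [Ring A] [Algebra F A] (T : A →ₗ[F] F) (σ : A →ₗ[F] A) (ℓ : A) :
    Ring (CliffordAlg F A T σ ℓ) := inferInstanceAs (Ring (RingQuot _))

instance (A : Type) [Ring A] [Algebra F A] (T : A →ₗ[F] F) (σ : A →ₗ[F] A) (ℓ : A) :
    Algebra F (CliffordAlg F A T σ ℓ) := inferInstanceAs (Algebra F (RingQuot _))

/-- The canonical image of `a ∈ A` as a degree-one element of the Clifford algebra. -/
def cliffGen (A : Type) [Ring A] [Algebra F A] (T : A →ₗ[F] F)
    (σ : A →ₗ[F] A) (ℓ : A) (a : A) : CliffordAlg F A T σ ℓ :=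
  RingQuot.mkAlgHom F (CliffordRel F A T σ ℓ) (TensorAlgebra.ι F a)

/-- The quadratic pair `(σ, f)` has trivial discriminant: the centre of its Clifford
algebra is the split étale quadratic algebra, i.e. contains a nontrivial idempotent. -/
def HasTrivialDiscriminant (A : Type) [Ring A] [Algebra F A] (T : A →ₗ[F] F)
    (σ : A →ₗ[F] A) (ℓ : A) : Prop :=
  ∃ e : CliffordAlg F A T σ ℓ, e ∈ Subalgebra.center F (CliffordAlg F A T σ ℓ) ∧
    e * e = e ∧ e ≠ 0 ∧ e ≠ 1

/-- `(A, σ)` (an algebra with involution) is a quadratic extension of the algebra with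
unitary involution `(C, σ_C)`, where `uC` is a distinguished generator of the centre `K`
of `C` over `F`:  `C` embeds in `A` compatibly with the involutions, with image the
centralizer of the image of `K`. -/
def IsInvQuadExt (A : Type) [Ring A] [Algebra F A] (σ : A →ₗ[F] A)
    (C : Type) [Ring C] [Algebra F C] (σC : C →ₗ[F] C) (uC : C) : Prop :=
  ∃ j : C →ₐ[F] A, Function.Injective j ∧ (∀ x : C, σ (j x) = j (σC x)) ∧
    (Set.range (j : C → A) = Set.centralizer {j uC})

/-- `(A, σ, f_ℓ)` (an algebra with quadratic pair) is a quadratic extension of the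
algebra with unitary involution `(C, σ_C)`:  in addition to the conditions of
`IsInvQuadExt`, the semi-trace `f_ℓ` coincides on symmetric elements with `f_{ℓK}` for
some generator `ℓK` of the quadratic étale algebra `K = F[j(uC)] ⊆ A` with
`ℓK² - ℓK ∈ F`. -/
def IsQPQuadExt (A : Type) [Ring A] [Algebra F A] (T : A →ₗ[F] F)
    (σ : A →ₗ[F] A) (ℓ : A)
    (C : Type) [Ring C] [Algebra F C] (σC : C →ₗ[F] C) (uC : C) : Prop :=
  ∃ j : C →ₐ[F] A, Function.Injective j ∧ (∀ x : C, σ (j x) = j (σC x)) ∧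
    (Set.range (j : C → A) = Set.centralizer {j uC}) ∧
    ∃ ℓK ∈ Algebra.adjoin F ({j uC} : Set A),
      ℓK ∉ Set.range (algebraMap F A) ∧
      (ℓK * ℓK - ℓK) ∈ Set.range (algebraMap F A) ∧
      ∀ s : A, σ s = s → T (ℓ * s) = T (ℓK * s)

/-- The algebra with unitary involution `(C, σ_C)` is isotropic: there is a nonzero
right ideal `J` with `σ_C(J)·J = 0`. -/
def UnitaryIsotropic (C : Type) [Ring C] [Algebra F C] (σC : C →ₗ[F] C) : Prop :=
  ∃ J : Submodule F C, IsRightIdeal F C J ∧ (∀ x ∈ J, ∀ y ∈ J, σC x * y = 0) ∧ J ≠ ⊥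

/-- The algebra with unitary involution `(C, σ_C)` is hyperbolic: there is a right
ideal `J` with `σ_C(J)·J = 0` of half the dimension (over `F`; equivalently, of half the
dimension over the centre). -/
def UnitaryHyperbolic (C : Type) [Ring C] [Algebra F C] (σC : C →ₗ[F] C) : Prop :=
  ∃ J : Submodule F C, IsRightIdeal F C J ∧ (∀ x ∈ J, ∀ y ∈ J, σC x * y = 0) ∧
    2 * Module.finrank F J = Module.finrank F C

/-- The 3-fold quadratic Pfister form `⟨⟨a, b, c]]` on `F⁸`. -/
def pfister3Form (a b c : F) : (Fin 8 → F) → F := fun v =>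
  (v 0 * v 0 + v 0 * v 1 + c * (v 1 * v 1))
  + a * (v 2 * v 2 + v 2 * v 3 + c * (v 3 * v 3))
  + b * (v 4 * v 4 + v 4 * v 5 + c * (v 5 * v 5))
  + a * b * (v 6 * v 6 + v 6 * v 7 + c * (v 7 * v 7))

/-- `I_q³ F = 0`: every 3-fold quadratic Pfister form over `F` is hyperbolic, i.e.
vanishes on a totally isotropic subspace of half the dimension. -/
def I3Trivial : Prop :=
  ∀ a b c : F, a ≠ 0 → b ≠ 0 → (1 : F) - 4 * c ≠ 0 →
    ∃ W : Submodule F (Fin 8 → F), Module.finrank F W = 4 ∧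
      ∀ v ∈ W, pfister3Form F a b c v = 0

/-- An algebra with quadratic pair, bundled. -/
structure QPAlgebra : Type 1 where
  A : Type
  [ring : Ring A]
  [alg : Algebra F A]
  T : A →ₗ[F] F
  σ : A →ₗ[F] A
  ℓ : A
  csa : IsCSA F A
  trd : IsReducedTrace F A T
  pair : IsQuadraticPair F A T σ ℓ

attribute [instance] QPAlgebra.ring QPAlgebra.alg

/-- A trialitarian triple: three degree-8 algebras with quadratic pair such that the
Clifford algebra of the first, with its canonical quadratic pair, is isomorphic to the
product of the other two.  The isomorphism intertwines the canonical involution of the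
Clifford algebra (which maps the degree-one generator attached to `a` to the one
attached to `σ(a)`) with the product involution; since the degree-one elements generate
the Clifford algebra, this is recorded on generators. -/
def IsTrialitarianTriple (X Y Z : QPAlgebra F) : Prop :=
  Module.finrank F X.A = 64 ∧ Module.finrank F Y.A = 64 ∧ Module.finrank F Z.A = 64 ∧
  ∃ φ : CliffordAlg F X.A X.T X.σ X.ℓ ≃ₐ[F] (Y.A × Z.A),
    ∀ a : X.A,
      φ (cliffGen F X.A X.T X.σ X.ℓ (X.σ a)) =
        (Y.σ (φ (cliffGen F X.A X.T X.σ X.ℓ a)).1,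
         Z.σ (φ (cliffGen F X.A X.T X.σ X.ℓ a)).2)

/-- A trialitarian triple is isotropic if one of its three members is isotropic
(equivalently, by triality, each of them is). -/
def TripleIsotropic (X Y Z : QPAlgebra F) : Prop :=
  QPIsotropic F X.A X.T X.σ X.ℓ ∨ QPIsotropic F Y.A Y.T Y.σ Y.ℓ ∨
    QPIsotropic F Z.A Z.T Z.σ Z.ℓ

/-- The (unordered) triple of Schur indices of a trialitarian triple; the index
`ind T = (a, b, c)` with `a ≤ b ≤ c` of the paper corresponds to this multiset being
`{a, b, c}`. -/
def indexMultiset (X Y Z : QPAlgebra F) : Multiset ℕ :=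
  {schurIndex F X.A, schurIndex F Y.A, schurIndex F Z.A}

/-- The relations of the quaternion algebra `[a, b)_F = F⟨i, j⟩` with
`i² - i = a`, `j² = b`, `ji = (1 - i)j`. -/
inductive QuatRel (a b : F) : FreeAlgebra F (Fin 2) → FreeAlgebra F (Fin 2) → Prop
  | ii : QuatRel a b (FreeAlgebra.ι F 0 * FreeAlgebra.ι F 0)
      (FreeAlgebra.ι F 0 + algebraMap F _ a)
  | jj : QuatRel a b (FreeAlgebra.ι F 1 * FreeAlgebra.ι F 1) (algebraMap F _ b)
  | ji : QuatRel a b (FreeAlgebra.ι F 1 * FreeAlgebra.ι F 0)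
      ((1 - FreeAlgebra.ι F 0) * FreeAlgebra.ι F 1)

/-- The quaternion algebra `[a, b)_F`, presented by generators and relations. -/
def QuatAlg (a b : F) : Type := RingQuot (QuatRel F a b)

instance (a b : F) : Ring (QuatAlg F a b) := inferInstanceAs (Ring (RingQuot _))
instance (a b : F) : Algebra F (QuatAlg F a b) := inferInstanceAs (Algebra F (RingQuot _))

/-- A ring in which every nonzero element is invertible. -/
def IsDivision (A : Type) [Ring A] : Prop := ∀ x : A, x ≠ 0 → IsUnit x

end Triality

end

namespace Triality

/-- Coordinates with respect to the basis `1, u` of a two-dimensional algebra. -/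
theorem exists_coords {F K : Type} [Field F] [CommRing K] [Algebra F K]
    (hK2 : Module.finrank F K = 2) {u : K} (hugen : u ∉ Set.range (algebraMap F K)) :
    ∃ φ ψ : K →ₗ[F] F, (∀ k, k = algebraMap F K (φ k) + algebraMap F K (ψ k) * u) ∧
      φ 1 = 1 ∧ ψ 1 = 0 ∧ φ u = 0 ∧ ψ u = 1 := by
  have : Nontrivial K := by
    by_contra h
    rw [not_nontrivial_iff_subsingleton] at h
    rw [Module.finrank_zero_of_subsingleton] at hK2
    omega
  have hli : LinearIndependent F ![(1 : K), u] := by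
    rw [LinearIndependent.pair_iff' one_ne_zero]
    intro c hc
    exact hugen ⟨c, by rw [← hc, Algebra.smul_def, mul_one]⟩
  let b := basisOfLinearIndependentOfCardEqFinrank hli (by simp [hK2])
  have hb : ⇑b = ![(1 : K), u] := coe_basisOfLinearIndependentOfCardEqFinrank ..
  have h0 : b 0 = 1 := by simp [hb]
  have h1 : b 1 = u := by simp [hb]
  refine ⟨b.coord 0, b.coord 1, fun k => ?_, ?_, ?_, ?_, ?_⟩
  · conv_lhs => rw [← b.sum_repr k]
    simp [Fin.sum_univ_two, h0, h1, Algebra.smul_def]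
  · rw [← h0]; simp
  · rw [← h0]; simp
  · rw [← h1]; simp
  · rw [← h1]; simp

/-- The nontrivial automorphism of the quadratic algebra `F[u]`, `u² = u + a`. -/
theorem exists_conj {F K : Type} [Field F] [CommRing K] [Algebra F K]
    (hK2 : Module.finrank F K = 2) {u : K} {a : F} (hu : u * u = u + algebraMap F K a)
    (hugen : u ∉ Set.range (algebraMap F K)) :
    ∃ ι : K →ₐ[F] K, ι u = 1 - u ∧ (∀ k, ι (ι k) = k) ∧
      ∀ k, ι k = k → k ∈ Set.range (algebraMap F K) := by
  obtain ⟨φ, ψ, hk, h1, h2, h3, h4⟩ := exists_coords hK2 hugen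
  let f : K →ₗ[F] K :=
    (Algebra.linearMap F K).comp φ + (LinearMap.mulRight F (1 - u)).comp
      ((Algebra.linearMap F K).comp ψ)
  have hf : ∀ k, f k = algebraMap F K (φ k) + algebraMap F K (ψ k) * (1 - u) := fun k => by
    simp [f]
  have hφ (c d : F) : φ (algebraMap F K c + algebraMap F K d * u) = c := by
    rw [← Algebra.smul_def, Algebra.algebraMap_eq_smul_one, map_add, map_smul, map_smul, h1, h3]
    simp
  have hψ (c d : F) : ψ (algebraMap F K c + algebraMap F K d * u) = d := by
    rw [← Algebra.smul_def, Algebra.algebraMap_eq_smul_one, map_add, map_smul, map_smul, h2, h4]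
    simp
  have hf' (c d : F) : f (algebraMap F K c + algebraMap F K d * u) =
      algebraMap F K c + algebraMap F K d * (1 - u) := by rw [hf, hφ, hψ]
  have hmul : ∀ k l, f (k * l) = f k * f l := by
    intro k l
    have : k * l = algebraMap F K (φ k * φ l + ψ k * ψ l * a) +
        algebraMap F K (φ k * ψ l + ψ k * φ l + ψ k * ψ l) * u := by
      conv_lhs => rw [hk k, hk l]
      simp only [map_add, map_mul]
      linear_combination (algebraMap F K (ψ k) * algebraMap F K (ψ l)) * hu
    rw [this, hf', hf k, hf l]
    simp only [map_add, map_mul]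
    linear_combination -(algebraMap F K (ψ k) * algebraMap F K (ψ l)) * hu
  refine ⟨AlgHom.ofLinearMap f (by rw [hf, h1, h2]; simp) hmul, ?_, ?_, ?_⟩
  · simp [hf, h3, h4]
  · intro k
    change f (f k) = k
    have : f k = algebraMap F K (φ k + ψ k) + algebraMap F K (- ψ k) * u := by
      rw [hf]; simp only [map_add, map_neg]; ring
    rw [this, hf']
    conv_rhs => rw [hk k]
    simp only [map_add, map_neg]; ring
  · intro k hk'
    change f k = k at hk'
    have h5 : f k = algebraMap F K (φ k + ψ k) + algebraMap F K (- ψ k) * u := by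
      rw [hf]; simp only [map_add, map_neg]; ring
    have h6 : φ k + ψ k = φ k := by rw [← hφ (φ k + ψ k) (-ψ k), ← h5, hk']
    refine ⟨φ k, ?_⟩
    conv_rhs => rw [hk k]
    simp [add_eq_left.mp h6]

/-- Coordinates of `K ⊗ A` with respect to the basis `1, u` of `K`. -/
theorem exists_tensor_coords {F K A : Type} [Field F] [CommRing K] [Algebra F K]
    [Ring A] [Algebra F A]
    (hK2 : Module.finrank F K = 2) {u : K} (hugen : u ∉ Set.range (algebraMap F K)) :
    (∀ z : K ⊗[F] A, ∃ x y : A, z = (1 : K) ⊗ₜ[F] x + u ⊗ₜ[F] y) ∧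
      ∀ x y : A, (1 : K) ⊗ₜ[F] x + u ⊗ₜ[F] y = 0 → x = 0 ∧ y = 0 := by
  obtain ⟨φ, ψ, hk, h1, h2, h3, h4⟩ := exists_coords hK2 hugen
  constructor
  · intro z
    induction z with
    | zero => exact ⟨0, 0, by simp⟩
    | add z w hz hw =>
      obtain ⟨x, y, rfl⟩ := hz
      obtain ⟨x', y', rfl⟩ := hw
      exact ⟨x + x', y + y', by simp only [TensorProduct.tmul_add]; abel⟩
    | tmul k x =>
      refine ⟨φ k • x, ψ k • x, ?_⟩
      conv_lhs => rw [hk k]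
      rw [← Algebra.smul_def, Algebra.algebraMap_eq_smul_one, TensorProduct.add_tmul,
        TensorProduct.smul_tmul, TensorProduct.smul_tmul]
  · intro x y h
    constructor
    · simpa [h1, h3] using congrArg (fun z => TensorProduct.lid F A (φ.rTensor A z)) h
    · simpa [h2, h4] using congrArg (fun z => TensorProduct.lid F A (ψ.rTensor A z)) h

theorem IsReducedTrace.map_mul_comm {F A : Type} [Field F] [Ring A] [Algebra F A]
    {T : A →ₗ[F] F} (hT : IsReducedTrace F A T) (x y : A) : T (x * y) = T (y * x) := by
  obtain ⟨E, _, _, n, e, he⟩ := hT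
  apply (algebraMap F E).injective
  rw [he, he, ← one_mul (1 : E), ← Algebra.TensorProduct.tmul_mul_tmul,
    ← Algebra.TensorProduct.tmul_mul_tmul, map_mul, map_mul, Matrix.trace_mul_comm]

/-- Elements of a semisimple ring are von Neumann regular. -/
theorem exists_mul_mul_eq_self {A : Type} [Ring A] [IsSemisimpleRing A] (z : A) :
    ∃ k, z * k * z = z := by
  obtain ⟨J, hJ⟩ := exists_isCompl (Submodule.span A {z})
  have h1 : (1 : A) ∈ Submodule.span A {z} ⊔ J := by rw [hJ.sup_eq_top]; trivial
  obtain ⟨y, hy, j, hj, hyj⟩ := Submodule.mem_sup.mp h1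
  obtain ⟨k, rfl⟩ := Submodule.mem_span_singleton.mp hy
  refine ⟨k, ?_⟩
  have h2 : z * j = z - z * k * z := by
    rw [eq_sub_iff_add_eq', mul_assoc, ← smul_eq_mul k z, ← mul_add, hyj, mul_one]
  have h3 : z * j ∈ Submodule.span A {z} := by
    rw [h2]
    exact sub_mem (Submodule.mem_span_singleton_self z)
      (Submodule.mem_span_singleton.mpr ⟨z * k, rfl⟩)
  have h4 : z * j = 0 := by
    have := hJ.disjoint.le_bot ⟨h3, J.smul_mem z hj⟩
    simpa using this
  rw [h2, sub_eq_zero] at h4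
  exact h4.symm
/-- If `I_q³F = 0`, six-dimensional Pfister neighbours `n ⟂ a n ⟂ b n` are isotropic. -/
theorem I3Trivial.exists_isotropic {F : Type} [Field F] (h3 : I3Trivial F) {a b c : F}
    (ha : a ≠ 0) (hb : b ≠ 0) (hc : (1 : F) - 4 * c ≠ 0) :
    ∃ v : Fin 8 → F, v ≠ 0 ∧ v 6 = 0 ∧ v 7 = 0 ∧ pfister3Form F a b c v = 0 := by
  obtain ⟨W, hW, hq⟩ := h3 a b c ha hb hc
  let f : W →ₗ[F] F × F :=
    ((LinearMap.proj 6).prod (LinearMap.proj 7) : (Fin 8 → F) →ₗ[F] F × F).comp W.subtype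
  have hf : LinearMap.ker f ≠ ⊥ := LinearMap.ker_ne_bot_of_finrank_lt (by simp [hW])
  obtain ⟨v, hv, hv0⟩ := Submodule.exists_mem_ne_zero_of_ne_bot hf
  have hv' : (v : Fin 8 → F) 6 = 0 ∧ (v : Fin 8 → F) 7 = 0 := by
    simpa [f] using hv
  exact ⟨v, by simpa using hv0, hv'.1, hv'.2, hq v v.2⟩

/-- If `I_q³F = 0`, hermitian forms of dimension at least three over a quadratic separable
extension of `F` are isotropic. -/
theorem I3Trivial.exists_hermitian_isotropic {F K : Type} [Field F] (h3 : I3Trivial F)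
    [Field K] [Algebra F K] {u : K} {a : F} (hu : u * u = u + algebraMap F K a)
    (hugen : u ∉ Set.range (algebraMap F K)) (ha : (1 : F) + 4 * a ≠ 0)
    (ι : K →ₐ[F] K) (hιu : ι u = 1 - u)
    (hfix : ∀ k, ι k = k → k ∈ Set.range (algebraMap F K))
    {V : Type} [AddCommGroup V] [Module K V] [Module.Finite K V] (hV : 3 ≤ Module.finrank K V)
    (h : V → V →ₗ[K] K) (hherm : ∀ v w, h w v = ι (h v w)) :
    ∃ v, v ≠ 0 ∧ h v v = 0 := by
  by_contra! haniso
  have : Nontrivial V := Module.nontrivial_of_finrank_pos (R := K) (by omega)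
  obtain ⟨v₁, hv₁⟩ := exists_ne (0 : V)
  have hker₁ : LinearMap.ker (h v₁) ≠ ⊥ :=
    LinearMap.ker_ne_bot_of_finrank_lt (by simp; omega)
  obtain ⟨v₂, h₁₂, hv₂⟩ := Submodule.exists_mem_ne_zero_of_ne_bot hker₁
  have hker₂ : LinearMap.ker ((h v₁).prod (h v₂)) ≠ ⊥ :=
    LinearMap.ker_ne_bot_of_finrank_lt (by simp; omega)
  obtain ⟨v₃, h₃, hv₃⟩ := Submodule.exists_mem_ne_zero_of_ne_bot hker₂
  rw [LinearMap.mem_ker] at h₁₂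
  obtain ⟨h₁₃, h₂₃⟩ : h v₁ v₃ = 0 ∧ h v₂ v₃ = 0 := Prod.mk.inj (LinearMap.mem_ker.mp h₃)
  have h₂₁ : h v₂ v₁ = 0 := by rw [hherm, h₁₂, map_zero]
  have h₃₁ : h v₃ v₁ = 0 := by rw [hherm, h₁₃, map_zero]
  have h₃₂ : h v₃ v₂ = 0 := by rw [hherm, h₂₃, map_zero]
  obtain ⟨d₁, hd₁⟩ := hfix _ (hherm v₁ v₁).symm
  obtain ⟨d₂, hd₂⟩ := hfix _ (hherm v₂ v₂).symm
  obtain ⟨d₃, hd₃⟩ := hfix _ (hherm v₃ v₃).symm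
  have hne {d : F} {v : V} (hv : v ≠ 0) (hd : algebraMap F K d = h v v) : d ≠ 0 := by
    rintro rfl
    exact haniso v hv (by rw [← hd, map_zero])
  have hd₁0 := hne hv₁ hd₁
  have hd₂0 := hne hv₂ hd₂
  have hd₃0 := hne hv₃ hd₃
  obtain ⟨x, hx0, hx6, hx7, hx⟩ := h3.exists_isotropic (a := d₂ / d₁) (b := d₃ / d₁) (c := -a)
    (div_ne_zero hd₂0 hd₁0) (div_ne_zero hd₃0 hd₁0) (by rwa [mul_neg, sub_neg_eq_add])
  let k (i j : Fin 8) : K := algebraMap F K (x i) + algebraMap F K (x j) * u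
  have hk0 (i j : Fin 8) (h0 : k i j = 0) : x i = 0 ∧ x j = 0 := by
    have hj : x j = 0 := by
      by_contra hj
      refine hugen ⟨-x i / x j, ?_⟩
      have : algebraMap F K (x j) ≠ 0 := by simpa using hj
      simp only [map_div₀, map_neg]
      field_simp
      linear_combination -h0
    refine ⟨?_, hj⟩
    simpa [k, hj] using h0
  have hN (i j : Fin 8) : ι (k i j) * k i j =
      algebraMap F K (x i * x i + x i * x j + -a * (x j * x j)) := by
    simp only [k, map_add, map_mul, AlgHom.commutes, hιu, map_neg]
    linear_combination -(algebraMap F K (x j) * algebraMap F K (x j)) * hu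
  set w := k 0 1 • v₁ + k 2 3 • v₂ + k 4 5 • v₃ with hw
  have e₁ : h v₁ w = k 0 1 * algebraMap F K d₁ := by simp [hw, h₁₂, h₁₃, hd₁]
  have e₂ : h v₂ w = k 2 3 * algebraMap F K d₂ := by simp [hw, h₂₁, h₂₃, hd₂]
  have e₃ : h v₃ w = k 4 5 * algebraMap F K d₃ := by simp [hw, h₃₁, h₃₂, hd₃]
  have hc (d : F) : ι (algebraMap F K d) = algebraMap F K d := ι.commutes d
  refine haniso w (fun hw0 => ?_) ?_
  · rw [hw0, map_zero] at e₁ e₂ e₃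
    have f {d : F} {κ : K} (hd : d ≠ 0) (e : 0 = κ * algebraMap F K d) : κ = 0 := by
      simpa [hd] using e
    have g₁ := hk0 _ _ (f hd₁0 e₁)
    have g₂ := hk0 _ _ (f hd₂0 e₂)
    have g₃ := hk0 _ _ (f hd₃0 e₃)
    apply hx0
    ext i
    fin_cases i <;> simp [g₁, g₂, g₃, hx6, hx7]
  · have : h w w = k 0 1 * (ι (k 0 1) * algebraMap F K d₁) +
        k 2 3 * (ι (k 2 3) * algebraMap F K d₂) + k 4 5 * (ι (k 4 5) * algebraMap F K d₃) := by
      conv_lhs => rw [hw, map_add, map_add, map_smul, map_smul, map_smul]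
      rw [hherm v₁ w, hherm v₂ w, hherm v₃ w, e₁, e₂, e₃]
      simp [hc]
    have hz : d₁ * (x 0 * x 0 + x 0 * x 1 + -a * (x 1 * x 1)) +
        d₂ * (x 2 * x 2 + x 2 * x 3 + -a * (x 3 * x 3)) +
        d₃ * (x 4 * x 4 + x 4 * x 5 + -a * (x 5 * x 5)) = 0 := by
      have := congrArg (d₁ * ·) hx
      simp only [pfister3Form, hx6, hx7, mul_zero, add_zero] at this
      rw [← this]
      field_simp
    calc h w w = algebraMap F K d₁ * (ι (k 0 1) * k 0 1) +
          algebraMap F K d₂ * (ι (k 2 3) * k 2 3) + algebraMap F K d₃ * (ι (k 4 5) * k 4 5) := by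
          rw [this]; ring
      _ = 0 := by rw [hN, hN, hN, ← map_mul, ← map_mul, ← map_mul, ← map_add, ← map_add, hz,
        map_zero]
/-- A unitary involution `τ` on a split algebra is adjoint to a hermitian form; if `I_q³F = 0`
and `e` is an idempotent of rank at least three, there is a nonzero isotropic element in the
image of `e`. -/
theorem I3Trivial.exists_unitary_isotropic {F K : Type} [Field F] (h3 : I3Trivial F)
    [Field K] [Algebra F K] {u : K} {a : F} (hu : u * u = u + algebraMap F K a)
    (hugen : u ∉ Set.range (algebraMap F K)) (ha : (1 : F) + 4 * a ≠ 0)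
    (ι : K →ₐ[F] K) (hιu : ι u = 1 - u)
    (hfix : ∀ k, ι k = k → k ∈ Set.range (algebraMap F K))
    {R : Type} [Ring R] [Algebra K R] {N : ℕ} (hN : 0 < N)
    (φ : R ≃ₐ[K] Matrix (Fin N) (Fin N) K)
    (τ : R →+ R) (hsmul : ∀ (k : K) z, τ (k • z) = ι k • τ z)
    (hmul : ∀ z w, τ (z * w) = τ w * τ z) (hinv : ∀ z, τ (τ z) = z)
    (e : R) (I : Submodule K R) (heI : ∀ z ∈ I, e * z = z)
    (hI : 2 * N < Module.finrank K I) :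
    ∃ w, w ≠ 0 ∧ e * w = w ∧ τ w * w = 0 := by
  have : Module.Finite K R := Module.Finite.equiv φ.symm.toLinearEquiv
  let o : Fin N := ⟨0, hN⟩
  let α (i : Fin N) : R := φ.symm (Matrix.single i o 1)
  let β (i : Fin N) : R := φ.symm (Matrix.single o i 1)
  let p : R := φ.symm (Matrix.single o o 1)
  have hαβ : ∑ i, α i * β i = 1 := by
    simp only [α, β, ← map_mul, ← map_sum, Matrix.single_mul_single_same, mul_one]
    rw [Matrix.sum_single_one, map_one]
  have hαp (i) : α i * p = α i := by
    simp only [α, p, ← map_mul, Matrix.single_mul_single_same, mul_one]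
  have hpβ (i) : p * β i = β i := by
    simp only [β, p, ← map_mul, Matrix.single_mul_single_same, mul_one]
  have hpp : p * p = p := hαp o
  have hp (z : R) : ∃ k : K, p * z * p = k • p := by
    refine ⟨φ z o o, φ.injective ?_⟩
    simp only [p, map_mul, map_smul, AlgEquiv.apply_symm_apply]
    rw [Matrix.single_mul_mul_single]
    simp
  have hp0 : p ≠ 0 := by
    intro h
    have := congrArg (fun z => φ z o o) h
    simp [p] at this
  have hαz (z : R) (hz : ∀ i, z * α i = 0) : z = 0 := by
    rw [← mul_one z, ← hαβ, Finset.mul_sum]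
    exact Finset.sum_eq_zero fun i _ => by rw [← mul_assoc, hz, zero_mul]
  have hβz (z : R) (hz : ∀ i, β i * z = 0) : z = 0 := by
    rw [← one_mul z, ← hαβ, Finset.sum_mul]
    exact Finset.sum_eq_zero fun i _ => by rw [mul_assoc, hz, mul_zero]
  -- the space of the hermitian form, and its dimension
  let V : Submodule K R :=
    { carrier := {v | e * v = v ∧ v * p = v}
      add_mem' := fun {v w} hv hw => ⟨by rw [mul_add, hv.1, hw.1], by rw [add_mul, hv.2, hw.2]⟩
      zero_mem' := by simp
      smul_mem' := fun k v hv => ⟨by rw [mul_smul_comm, hv.1], by rw [smul_mul_assoc, hv.2]⟩ }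
  have hV : 3 ≤ Module.finrank K V := by
    let f : I →ₗ[K] Fin N → V := LinearMap.pi fun i =>
      LinearMap.codRestrict V ((LinearMap.mulRight K (α i)).comp I.subtype) fun z =>
        ⟨by simp [← mul_assoc, heI z z.2], by simp [mul_assoc, hαp]⟩
    have hf : Function.Injective f := by
      rw [← LinearMap.ker_eq_bot, LinearMap.ker_eq_bot']
      intro z hz
      refine Subtype.ext (hαz _ fun i => ?_)
      exact congrArg Subtype.val (congrFun hz i)
    have := LinearMap.finrank_le_finrank_of_injective hf
    rw [Module.finrank_pi_fintype] at this
    simp only [Finset.sum_const, Finset.card_univ, Fintype.card_fin, smul_eq_mul] at this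
    by_contra! h
    have : N * Module.finrank K V ≤ N * 2 := Nat.mul_le_mul_left _ (by omega)
    omega
  -- the line in which the form takes its values
  have hτinj {z : R} (hz : τ z = 0) : z = 0 := by rw [← hinv z, hz, map_zero]
  obtain ⟨z, hz0⟩ : ∃ z, τ p * z * p ≠ 0 := by
    by_contra! h
    refine hp0 (hτinj (hαz _ fun i => ?_))
    rw [← hαp i, ← mul_assoc, h]
  have hτpp : τ p * τ p = τ p := by rw [← hmul, hpp]
  obtain ⟨g, hg0, hgp, hpg, hτg⟩ : ∃ g, g ≠ 0 ∧ g * p = g ∧ τ p * g = g ∧ τ g = g := by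
    let y := τ p * z * p
    have h1 (k : K) : (k • y + τ (k • y)) * p = k • y + τ (k • y) := by
      simp [y, hmul, hinv, hsmul, add_mul, mul_assoc, hpp]
    have h2 (k : K) : τ p * (k • y + τ (k • y)) = k • y + τ (k • y) := by
      simp only [y, hmul, hinv, hsmul, mul_add, mul_smul_comm]
      simp only [← mul_assoc, hτpp]
    have h3 (k : K) : τ (k • y + τ (k • y)) = k • y + τ (k • y) := by
      rw [map_add, hinv, add_comm]
    by_contra! h
    have h4 (k : K) : k • y + τ (k • y) = 0 := by
      by_contra h'
      exact h _ h' (h1 k) (h2 k) (h3 k)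
    have h5 := h4 1
    have h6 := h4 u
    rw [one_smul] at h5
    rw [hsmul, eq_neg_of_add_eq_zero_right h5, smul_neg, ← sub_eq_add_neg, ← sub_smul,
      smul_eq_zero, or_iff_left hz0, sub_eq_zero] at h6
    exact hugen (hfix u h6.symm)
  have hline (s : R) (hs : τ p * s = s) (hs' : s * p = s) : ∃ k : K, s = k • g := by
    obtain ⟨i, hi⟩ : ∃ i, β i * g ≠ 0 := by
      by_contra! h
      exact hg0 (hβz _ h)
    obtain ⟨κ, hκ⟩ := hp (β i * g)
    rw [← mul_assoc p, hpβ, mul_assoc, hgp] at hκ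
    have hκ0 : κ ≠ 0 := by
      rintro rfl
      exact hi (by rw [hκ, zero_smul])
    let b := κ⁻¹ • (β i * τ p)
    have hbg : b * g = p := by
      simp only [b, smul_mul_assoc, mul_assoc, hpg]
      rw [hκ, smul_smul, inv_mul_cancel₀ hκ0, one_smul]
    have hpb : p * b = b := by simp [b, ← mul_assoc, hpβ]
    have hbp : b * τ p = b := by simp [b, mul_assoc, hτpp]
    obtain ⟨μ, hμ⟩ := hp (τ (g * b))
    have hgb : g * b = ι μ • τ p := by
      have := congrArg τ hμ
      rw [hsmul, hmul, hmul, hinv, mul_assoc g, hbp, ← mul_assoc, hpg] at this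
      exact this
    have hμ1 : ι μ • g = g := by
      have : g * b * g = g := by rw [mul_assoc, hbg, hgp]
      rwa [hgb, smul_mul_assoc, hpg] at this
    obtain ⟨k, hk⟩ := hp (b * s)
    rw [← mul_assoc p, hpb, mul_assoc, hs'] at hk
    have hμ' : ι μ = 1 := by
      have : (ι μ - 1) • g = 0 := by rw [sub_smul, hμ1, one_smul, sub_self]
      rwa [smul_eq_zero, or_iff_left hg0, sub_eq_zero] at this
    refine ⟨k, ?_⟩
    calc s = g * b * s := by rw [hgb, hμ', one_smul, hs]
      _ = k • g := by rw [mul_assoc, hk, mul_smul_comm, hgp]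
  have hinj {k l : K} (hkl : k • g = l • g) : k = l := smul_left_injective K hg0 hkl
  have hform (v w : V) : ∃ k : K, τ (v : R) * w = k • g :=
    hline _ (by rw [← mul_assoc, ← hmul, v.2.2]) (by rw [mul_assoc, w.2.2])
  choose h hh using hform
  obtain ⟨v, hv0, hv⟩ := h3.exists_hermitian_isotropic hu hugen ha ι hιu hfix hV
    (fun v =>
      { toFun := h v
        map_add' := fun w w' => hinj (by
          rw [add_smul, ← hh, ← hh, ← hh, Submodule.coe_add, mul_add])
        map_smul' := fun k w => hinj (by
          rw [RingHom.id_apply, smul_eq_mul, mul_smul, ← hh, ← hh, Submodule.coe_smul,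
            mul_smul_comm]) })
    (fun v w => hinj (by
      change h w v • g = ι (h v w) • g
      have := congrArg τ (hh v w)
      rw [hmul, hinv, hsmul, hτg] at this
      rw [← hh, this]))
  refine ⟨v, by simpa using hv0, v.2.1, ?_⟩
  rw [hh]
  change h v v = 0 at hv
  rw [hv, zero_smul]
theorem baseChange_anti {F K A : Type} [Field F] [CommRing K] [Algebra F K]
    [Ring A] [Algebra F A] {σ : A →ₗ[F] A} (hσ : IsInvolution F σ) (z w : K ⊗[F] A) :
    σ.baseChange K (z * w) = σ.baseChange K w * σ.baseChange K z := by
  induction z with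
  | zero => simp
  | add z z' hz hz' => rw [add_mul, map_add, hz, hz', map_add, mul_add]
  | tmul k x =>
    induction w with
    | zero => simp
    | add w w' hw hw' => rw [mul_add, map_add, hw, hw', map_add, add_mul]
    | tmul l y => simp [hσ.1, mul_comm]

theorem baseChange_involutive {F K A : Type} [Field F] [CommRing K] [Algebra F K]
    [Ring A] [Algebra F A] {σ : A →ₗ[F] A} (hσ : IsInvolution F σ) (z : K ⊗[F] A) :
    σ.baseChange K (σ.baseChange K z) = z := by
  induction z with
  | zero => simp
  | add z z' hz hz' => rw [map_add, map_add, hz, hz']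
  | tmul k x => simp [hσ.2]

/-- An isotropic ideal of `A_K` contains no nonzero elements `p ⊗ s` if `(A, σ, f)` is
anisotropic. -/
theorem eq_zero_of_tmul_mem {F K A : Type} [Field F] [CommRing K] [Algebra F K]
    [Ring A] [Algebra F A] {T : A →ₗ[F] F} {σ : A →ₗ[F] A} {ℓ : A}
    (haniso : ¬ QPIsotropic F A T σ ℓ) {TK : K ⊗[F] A →ₗ[K] K}
    (hTK : ∀ (c : K) (x : A), TK (c ⊗ₜ[F] x) = c * algebraMap F K (T x))
    {I : Submodule K (K ⊗[F] A)}
    (hI : IsIsotropicIdeal K (K ⊗[F] A) TK (σ.baseChange K) ((1 : K) ⊗ₜ[F] ℓ) I)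
    {p : K} (hp : p ≠ 0) (hpp : ∀ a : A, (p * p) ⊗ₜ[F] a = 0 → a = 0)
    {s : A} (hs : p ⊗ₜ[F] s ∈ I) : s = 0 := by
  by_contra hs0
  refine haniso ⟨(I.restrictScalars F).comap (TensorProduct.mk F K A p), ⟨?_, ?_, ?_⟩, ?_⟩
  · intro x hx b
    simpa using hI.1 _ hx ((1 : K) ⊗ₜ[F] b)
  · intro x hx y hy
    have := hI.2.1 _ hx _ hy
    simp only [TensorProduct.mk_apply, LinearMap.baseChange_tmul,
      Algebra.TensorProduct.tmul_mul_tmul] at this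
    exact hpp _ this
  · intro x hx hsx
    have := hI.2.2 _ hx (by simp [hsx])
    simp only [TensorProduct.mk_apply, Algebra.TensorProduct.tmul_mul_tmul, one_mul, hTK] at this
    rw [mul_comm, ← Algebra.smul_def, smul_eq_zero] at this
    exact this.resolve_right hp
  · intro h
    have : s ∈ (I.restrictScalars F).comap (TensorProduct.mk F K A p) := hs
    rw [h] at this
    exact hs0 (by simpa using this)

/-- If `X² - X - a` has a root in `F`, an anisotropic quadratic pair has no nonzero
isotropic ideals over `F[X]/(X² - X - a)`. -/
theorem eq_bot_of_root {F K A : Type} [Field F] [CommRing K] [Algebra F K]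
    [Ring A] [Algebra F A] {T : A →ₗ[F] F} {σ : A →ₗ[F] A} {ℓ : A}
    (haniso : ¬ QPIsotropic F A T σ ℓ) {TK : K ⊗[F] A →ₗ[K] K}
    (hTK : ∀ (c : K) (x : A), TK (c ⊗ₜ[F] x) = c * algebraMap F K (T x))
    {I : Submodule K (K ⊗[F] A)}
    (hI : IsIsotropicIdeal K (K ⊗[F] A) TK (σ.baseChange K) ((1 : K) ⊗ₜ[F] ℓ) I)
    (hK2 : Module.finrank F K = 2)
    {u : K} {a : F} (hu : u * u = u + algebraMap F K a)
    (hugen : u ∉ Set.range (algebraMap F K)) (ha : (1 : F) + 4 * a ≠ 0)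
    {r : F} (hr : r * r = r + a) : I = ⊥ := by
  obtain ⟨hspan, hindep⟩ := exists_tensor_coords (A := A) hK2 hugen
  have h2 : 2 * r - 1 ≠ 0 := by
    intro h
    apply ha
    linear_combination (2 * r - 1) * h - 4 * hr
  have key (r : F) (hr : r * r = r + a) (h2 : 2 * r - 1 ≠ 0) (x y : A)
      (hz : (1 : K) ⊗ₜ[F] x + u ⊗ₜ[F] y ∈ I) : x + r • y = 0 := by
    have hur : u * u = u + algebraMap F K (r * r - r) := by
      rw [hu, hr, add_sub_cancel_left]
    set p : K := u - algebraMap F K (1 - r) with hp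
    have hp0 : p ≠ 0 := fun h => hugen ⟨1 - r, (sub_eq_zero.mp h).symm⟩
    have hpu : p * u = r • p := by
      rw [hp, Algebra.smul_def]
      simp only [map_sub, map_one, map_mul] at hur ⊢
      linear_combination hur
    have hpp : p * p = (2 * r - 1) • p := by
      rw [hp, Algebra.smul_def]
      simp only [map_sub, map_one, map_mul, map_ofNat] at hur ⊢
      linear_combination hur
    refine eq_zero_of_tmul_mem haniso hTK hI hp0 (fun b hb => ?_) (s := x + r • y) ?_
    · rw [hpp, TensorProduct.smul_tmul, hp, TensorProduct.sub_tmul,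
        Algebra.algebraMap_eq_smul_one, TensorProduct.smul_tmul, sub_eq_add_neg,
        ← TensorProduct.tmul_neg, add_comm] at hb
      exact (smul_eq_zero.mp (hindep _ _ hb).2).resolve_left h2
    · have := I.smul_mem p hz
      rwa [smul_add, TensorProduct.smul_tmul', TensorProduct.smul_tmul', smul_eq_mul,
        smul_eq_mul, mul_one, hpu, TensorProduct.smul_tmul, ← TensorProduct.tmul_add] at this
  rw [eq_bot_iff]
  intro z hz
  obtain ⟨x, y, rfl⟩ := hspan z
  have e₁ := key r hr h2 x y hz
  have e₂ := key (1 - r) (by linear_combination hr) (by contrapose h2; linear_combination -h2)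
    x y hz
  have hy : y = 0 := by
    have : (2 * r - 1) • y = 0 := by
      have := congrArg₂ (· - ·) e₁ e₂
      simp only [sub_zero, add_sub_add_left_eq_sub, ← sub_smul] at this
      rw [← this]; congr 1; ring
    exact (smul_eq_zero.mp this).resolve_left h2
  have hx : x = 0 := by simpa [hy] using e₁
  simp [hx, hy]

/-- Without a root of `X² - X - a`, the quadratic algebra is a field. -/
theorem isField_of_no_root {F K : Type} [Field F] [CommRing K] [Algebra F K]
    (hK2 : Module.finrank F K = 2)
    {u : K} {a : F} (hu : u * u = u + algebraMap F K a)
    (hugen : u ∉ Set.range (algebraMap F K))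
    (hr : ∀ r : F, r * r ≠ r + a) : IsField K := by
  obtain ⟨φ, ψ, hk, h1, -⟩ := exists_coords hK2 hugen
  refine ⟨⟨0, 1, fun h => ?_⟩, mul_comm, fun {k} hk0 => ?_⟩
  · rw [← h, map_zero] at h1
    exact zero_ne_one h1
  · set c := φ k
    set d := ψ k
    have hn : c * c + c * d - a * (d * d) ≠ 0 := by
      intro h
      by_cases hd : d = 0
      · have hc : c = 0 := by simpa [hd] using h
        exact hk0 (by rw [hk k]; simp [c, d] at hc hd; simp [hc, hd])
      · apply hr (-c / d)
        field_simp
        linear_combination h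
    refine ⟨algebraMap F K (c * c + c * d - a * (d * d))⁻¹ *
      (algebraMap F K c + algebraMap F K d * (1 - u)), ?_⟩
    have : k * (algebraMap F K c + algebraMap F K d * (1 - u)) =
        algebraMap F K (c * c + c * d - a * (d * d)) := by
      conv_lhs => rw [hk k]
      simp only [map_add, map_sub, map_mul]
      linear_combination -(algebraMap F K d * algebraMap F K d) * hu
    rw [mul_left_comm, this, ← map_mul, inv_mul_cancel₀ hn, map_one]
/-- A right ideal `dA` with `σ(d)d = 0` is isotropic as soon as the semi-trace vanishes on the
symmetric elements of `d A σ(d)`. -/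
theorem qpIsotropic_of_mul_eq_zero {F A : Type} [Field F] [Ring A] [Algebra F A]
    [IsSemisimpleRing A] {T : A →ₗ[F] F} {σ : A →ₗ[F] A} {ℓ : A} (hσ : IsInvolution F σ)
    {d : A} (hd : d ≠ 0) (hdd : σ d * d = 0)
    (hT : ∀ b, σ (d * b * σ d) = d * b * σ d → T (ℓ * (d * b * σ d)) = 0) :
    QPIsotropic F A T σ ℓ := by
  refine ⟨LinearMap.range (LinearMap.mulLeft F d), ⟨?_, ?_, ?_⟩, ?_⟩
  · rintro _ ⟨x, rfl⟩ b
    exact ⟨x * b, by simp [mul_assoc]⟩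
  · rintro _ ⟨x, rfl⟩ _ ⟨y, rfl⟩
    simp only [LinearMap.mulLeft_apply, hσ.1]
    rw [mul_assoc, ← mul_assoc (σ d), hdd, zero_mul, mul_zero]
  · rintro _ ⟨x, rfl⟩ hs
    simp only [LinearMap.mulLeft_apply] at hs ⊢
    obtain ⟨k, hk⟩ := exists_mul_mul_eq_self d
    have h1 : d * x = d * (k * (d * x) * σ k) * σ d := by
      have h2 : d * k * (d * x) = d * x := by rw [← mul_assoc, hk]
      have h3 := congrArg σ h2
      rw [hσ.1 (d * k), hs, hσ.1] at h3
      conv_lhs => rw [← h3, ← h2]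
      simp only [mul_assoc]
    rw [h1] at hs ⊢
    exact hT _ hs
  · intro h
    have : d ∈ LinearMap.range (LinearMap.mulLeft F d) := ⟨1, by simp⟩
    rw [h] at this
    exact hd (by simpa using this)

/-- The main theorem when the quadratic étale algebra `K` is a field. -/
theorem deg_le_four_of_field (F : Type) [Field F]
    (h3 : I3Trivial F)
    (A : Type) [Ring A] [Algebra F A] (hA : IsCSA F A)
    (T : A →ₗ[F] F) (hT : IsReducedTrace F A T)
    (σ : A →ₗ[F] A) (ℓ : A) (hqp : IsQuadraticPair F A T σ ℓ)
    (haniso : ¬ QPIsotropic F A T σ ℓ)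
    (K : Type) [Field K] [Algebra F K] (hK2 : Module.finrank F K = 2)
    (u : K) (a : F) (hu : u * u = u + algebraMap F K a)
    (hugen : u ∉ Set.range (algebraMap F K)) (ha : (1 : F) + 4 * a ≠ 0)
    (TK : K ⊗[F] A →ₗ[K] K)
    (hTK : ∀ (c : K) (x : A), TK (c ⊗ₜ[F] x) = c * algebraMap F K (T x))
    (hsplit : IsSplit K (K ⊗[F] A))
    (hhyp : QPHyperbolic K (K ⊗[F] A) TK (LinearMap.baseChange K σ) ((1 : K) ⊗ₜ[F] ℓ)) :
    deg F A ≤ 4 := by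
  obtain ⟨hcentral, hsimple, hfin⟩ := hA
  have : IsArtinianRing A := IsArtinianRing.of_finite F A
  obtain ⟨n, hn, ⟨φ⟩⟩ := hsplit
  have hdim : Module.finrank K (K ⊗[F] A) = n * n := by
    rw [φ.toLinearEquiv.finrank_eq, Module.finrank_matrix]
    simp
  have hdeg : deg F A = n := by
    rw [deg, ← Module.finrank_baseChange (R := K), hdim, Nat.sqrt_eq]
  rw [hdeg]
  by_contra! hn5
  apply haniso
  have : Module.Finite F K := Module.finite_of_finrank_pos (by omega)
  obtain ⟨hσ, -, hskew, hℓ⟩ := hqp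
  have hTσ (x : A) : T (σ x) = T x := by
    have := hskew (x - σ x) (by rw [map_sub, hσ.2, neg_sub])
    rw [map_sub, sub_eq_zero] at this
    exact this.symm
  obtain ⟨ι, hιu, hιι, hfix⟩ := exists_conj hK2 hu hugen
  obtain ⟨hspan, hindep⟩ := exists_tensor_coords (A := A) hK2 hugen
  obtain ⟨I, hI, hIdim⟩ := hhyp
  set S := LinearMap.baseChange K σ with hS
  have hSmul := baseChange_anti (K := K) hσ
  have hSS := baseChange_involutive (K := K) hσ
  rw [← hS] at hSmul hSS
  let c : K ⊗[F] A →ₐ[F] K ⊗[F] A := Algebra.TensorProduct.map ι (AlgHom.id F A)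
  have hct (k : K) (x : A) : c (k ⊗ₜ[F] x) = ι k ⊗ₜ[F] x := by simp [c]
  have hcc (z) : c (c z) = z := by
    induction z with
    | zero => simp
    | add z w hz hw => rw [map_add, map_add, hz, hw]
    | tmul k x => rw [hct, hct, hιι]
  have hcsmul (k : K) (z) : c (k • z) = ι k • c z := by
    rw [Algebra.smul_def, map_mul, Algebra.TensorProduct.algebraMap_apply, hct,
      Algebra.smul_def, Algebra.TensorProduct.algebraMap_apply]
    rfl
  have hcS (z) : c (S z) = S (c z) := by
    induction z with
    | zero => simp
    | add z w hz hw => rw [map_add, map_add, map_add, map_add, hz, hw]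
    | tmul k x => simp [hS, hct]
  have hTc (z) : TK (c z) = ι (TK z) := by
    induction z with
    | zero => simp
    | add z w hz hw => rw [map_add, map_add, map_add, map_add, hz, hw]
    | tmul k x => simp [hTK, hct]
  have hTS (z) : TK (S z) = TK z := by
    induction z with
    | zero => simp
    | add z w hz hw => rw [map_add, map_add, map_add, hz, hw]
    | tmul k x => simp [hS, hTK, hTσ]
  have hTcomm (z w) : TK (z * w) = TK (w * z) := by
    induction z with
    | zero => simp
    | add z z' hz hz' => rw [add_mul, map_add, hz, hz', mul_add, map_add]
    | tmul k x =>
      induction w with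
      | zero => simp
      | add w w' hw hw' => rw [mul_add, map_add, hw, hw', add_mul, map_add]
      | tmul l y => simp [hTK, hT.map_mul_comm x y, mul_comm k l]
  have htr (x y : A) : ((1 : K) ⊗ₜ[F] x + u ⊗ₜ[F] y) + c ((1 : K) ⊗ₜ[F] x + u ⊗ₜ[F] y) =
      (1 : K) ⊗ₜ[F] (2 • x + y) := by
    rw [map_add, hct, hct, hιu, map_one, TensorProduct.sub_tmul, two_nsmul]
    simp only [TensorProduct.tmul_add]
    abel
  -- `I` and its conjugate are complementary
  have hdisj (z) (hz : z ∈ I) (hcz : c z ∈ I) : z = 0 := by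
    have key {s : A} (hs : (1 : K) ⊗ₜ[F] s ∈ I) : s = 0 :=
      eq_zero_of_tmul_mem haniso hTK hI one_ne_zero
        (fun b hb => (hindep b 0 (by simpa using hb)).1) hs
    obtain ⟨x, y, rfl⟩ := hspan z
    have e₁ : 2 • x + y = 0 := key (by rw [← htr]; exact add_mem hz hcz)
    have huz : u • ((1 : K) ⊗ₜ[F] x + u ⊗ₜ[F] y) = (1 : K) ⊗ₜ[F] (a • y) + u ⊗ₜ[F] (x + y) := by
      rw [smul_add, TensorProduct.smul_tmul', TensorProduct.smul_tmul', smul_eq_mul, smul_eq_mul,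
        mul_one, hu, TensorProduct.add_tmul, Algebra.algebraMap_eq_smul_one,
        TensorProduct.smul_tmul, TensorProduct.tmul_add]
      abel
    have e₂ : 2 • (a • y) + (x + y) = 0 := key (by
      rw [← htr, ← huz, hcsmul]
      exact add_mem (I.smul_mem _ hz) (I.smul_mem _ hcz))
    have e₃ : ((1 : F) + 4 * a) • y = 0 := by
      have : ((1 : F) + 4 * a) • y = 2 • (2 • (a • y) + (x + y)) - (2 • x + y) := by
        module
      rw [this, e₁, e₂]; simp
    have hy : y = 0 := (smul_eq_zero.mp e₃).resolve_left ha
    have hx : x = 0 := by simpa [hy] using e₂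
    simp [hx, hy]
  obtain ⟨e, heI, hece⟩ : ∃ e ∈ I, e + c e = 1 := by
    let f : I × I →ₗ[F] K ⊗[F] A := (I.subtype.restrictScalars F).coprod
      (c.toLinearMap.comp (I.subtype.restrictScalars F))
    have hf (z w : I) : f (z, w) = z + c w := rfl
    have hf0 (z w : I) (h : (z : K ⊗[F] A) + c w = 0) : z = 0 ∧ w = 0 := by
      have hw : w = 0 := Subtype.ext (hdisj _ w.2 (by
        rw [eq_neg_of_add_eq_zero_right h]
        exact neg_mem z.2))
      refine ⟨Subtype.ext ?_, hw⟩
      simpa [hw] using h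
    have hinj : Function.Injective f := by
      rw [← LinearMap.ker_eq_bot, LinearMap.ker_eq_bot']
      rintro ⟨z, w⟩ h
      obtain ⟨rfl, rfl⟩ := hf0 z w h
      rfl
    have : Module.Finite F I := Module.Finite.trans K I
    have hrank : Module.finrank F (I × I) = Module.finrank F (K ⊗[F] A) := by
      rw [Module.finrank_prod, ← Module.finrank_mul_finrank F K I,
        ← Module.finrank_mul_finrank F K (K ⊗[F] A), ← hIdim]
      ring
    have hsurj := (LinearMap.injective_iff_surjective_of_finrank_eq_finrank hrank).mp hinj
    obtain ⟨⟨z, w⟩, hzw⟩ := hsurj 1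
    rw [hf] at hzw
    have h1 := congrArg c hzw
    rw [map_add, hcc, map_one, ← hzw] at h1
    have h2 := (hf0 (z - w) (w - z) (by
      simp only [Submodule.coe_sub, map_sub]
      rw [sub_add_sub_comm, ← h1, add_comm, sub_self])).1
    rw [sub_eq_zero] at h2
    exact ⟨z, z.2, by rw [← hzw, h2]⟩
  have hce : c e = 1 - e := eq_sub_of_add_eq' hece
  have hez (z) (hz : z ∈ I) : e * z = z := by
    have h1 : z - e * z = 0 := by
      refine hdisj _ (sub_mem hz (hI.1 _ heI _)) ?_
      have : z - e * z = c e * z := by rw [hce, sub_mul, one_mul]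
      rw [this, map_mul, hcc]
      exact hI.1 _ heI _
    exact (sub_eq_zero.mp h1).symm
  have hee : e * e = e := hez e heI
  have hcee : c e * e = 0 := by rw [hce, sub_mul, hee, one_mul, sub_self]
  have hece' : e * c e = 0 := by rw [hce, mul_sub, hee, mul_one, sub_self]
  have hS1 : S 1 = 1 := by
    have := hSmul (S 1) 1
    rw [mul_one, hSS, mul_one] at this
    exact this.symm
  have hSe : S e = c e := by
    have h1 : S e * e = 0 := hI.2.1 _ heI _ heI
    have h2 := congrArg c h1
    rw [map_mul, map_zero, hcS, hce, map_sub, hS1, sub_mul, mul_sub, one_mul, mul_sub, h1,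
      mul_one, one_mul, sub_zero] at h2
    rw [hce]
    exact (sub_eq_zero.mp h2).symm
  have hSce : S (c e) = e := by rw [← hSe, hSS]
  -- the semi-trace is given by `e`
  have hf (Z : K ⊗[F] A) (hSZ : S Z = Z) (hcZ : c Z = Z) :
      TK ((1 : K) ⊗ₜ[F] ℓ * Z) = TK (e * Z) := by
    set L := (1 : K) ⊗ₜ[F] ℓ with hL
    have hcL : c L = L := by rw [hL, hct, map_one]
    have hLS : L + S L = 1 := by
      rw [hL, hS, LinearMap.baseChange_tmul, ← TensorProduct.tmul_add, hℓ]
      rfl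
    have h1 : TK (L * (e * Z * c e)) = 0 := by
      refine hI.2.2 _ ?_ ?_
      · rw [mul_assoc]
        exact hI.1 _ heI _
      · rw [hSmul, hSmul, hSZ, hSce, hSe, mul_assoc]
    have h2 : TK (L * (c e * Z * e)) = 0 := by
      have := hTc (L * (e * Z * c e))
      rwa [h1, map_zero, map_mul c, map_mul c, map_mul c, hcc, hcZ, hcL] at this
    have h3 : TK (L * (c e * Z * c e)) = TK (S L * (e * Z * e)) := by
      rw [← hTS, hSmul, hSmul, hSmul, hSce, hSZ, hTcomm, mul_assoc e]
    have h4 : L * Z = L * (e * Z * e) + L * (c e * Z * c e) + L * (e * Z * c e) +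
        L * (c e * Z * e) := by
      rw [hce]; noncomm_ring
    rw [h4, map_add, map_add, map_add, h1, h2, h3, ← map_add, ← add_mul, hLS, one_mul,
      mul_assoc, hTcomm, mul_assoc, hee, hTcomm, add_zero, add_zero]
  -- an isotropic vector of the associated hermitian form
  obtain ⟨w, hw0, hew, hww⟩ := h3.exists_unitary_isotropic hu hugen ha ι hιu hfix hn φ
    (S.toAddMonoidHom.comp c.toRingHom.toAddMonoidHom)
    (fun k z => by
      change S (c (k • z)) = ι k • S (c z)
      rw [hcsmul, map_smul])
    (fun z w => by
      change S (c (z * w)) = S (c w) * S (c z)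
      rw [map_mul, hSmul])
    (fun z => by
      change S (c (S (c z))) = z
      rw [hcS, hcc, hSS])
    e I hez (by nlinarith)
  change S (c w) * w = 0 at hww
  have hSww : S w * w = 0 := by
    rw [← hew, hSmul, hSe, mul_assoc, ← mul_assoc (c e), hcee, zero_mul, mul_zero]
  have hecw : e * c w = 0 := by
    rw [← hew, map_mul, ← mul_assoc, hece', zero_mul]
  obtain ⟨d, hd⟩ : ∃ d : A, w + c w = (1 : K) ⊗ₜ[F] d := by
    obtain ⟨x, y, rfl⟩ := hspan w
    exact ⟨_, htr x y⟩
  have heC : e * (w + c w) = w := by rw [mul_add, hecw, hew, add_zero]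
  have hSd : (1 : K) ⊗ₜ[F] σ d = S w + S (c w) := by
    rw [← map_add, hd, hS, LinearMap.baseChange_tmul]
  refine qpIsotropic_of_mul_eq_zero hσ (d := d) ?_ ?_ ?_
  · rintro rfl
    rw [hd, TensorProduct.tmul_zero, mul_zero] at heC
    exact hw0 heC.symm
  · refine (hindep (σ d * d) 0 ?_).1
    have h1 : S (c w) * c w = 0 := by rw [← hcS, ← map_mul, hSww, map_zero]
    have h2 : S w * c w = 0 := by
      have := congrArg c hww
      rwa [map_mul, hcS, hcc, map_zero] at this
    rw [TensorProduct.tmul_zero, add_zero, ← one_mul (1 : K), ← Algebra.TensorProduct.tmul_mul_tmul,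
      hSd, ← hd, add_mul, mul_add, mul_add, hSww, hww, h1, h2]
    simp
  · intro b hs
    apply (algebraMap F K).injective
    have h1 := hf ((1 : K) ⊗ₜ[F] (d * b * σ d)) (by rw [hS, LinearMap.baseChange_tmul, hs])
      (by rw [hct, map_one])
    rw [Algebra.TensorProduct.tmul_mul_tmul, one_mul, hTK, one_mul] at h1
    rw [h1, map_zero, ← one_mul (1 : K), ← Algebra.TensorProduct.tmul_mul_tmul, hTcomm, mul_assoc,
      hSd, ← one_mul (1 : K), ← Algebra.TensorProduct.tmul_mul_tmul, hTcomm, ← hd, ← mul_assoc,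
      mul_assoc (S w + S (c w)), heC, add_mul, hSww, hww, add_zero, zero_mul, map_zero]

/-- Proposition 4.1 of the paper.  Assume `I_q³F = 0`.  Let
`(A, σ, f)` be an `F`-algebra with anisotropic quadratic pair.  If there exists an
étale quadratic `F`-algebra `K` such that `(A, σ, f) ⊗_F K` is split and hyperbolic,
then `deg A ≤ 4`.  (The base change of the quadratic pair is `(σ_K, f_{1 ⊗ ℓ})`, where
`T_K` is the reduced trace of `A_K`, i.e. the base change of `T`.) -/
theorem deg_le_four_of_split_hyperbolic_quadratic_ext (F : Type) [Field F]
    (h3 : I3Trivial F)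
    (A : Type) [Ring A] [Algebra F A] (hA : IsCSA F A)
    (T : A →ₗ[F] F) (hT : IsReducedTrace F A T)
    (σ : A →ₗ[F] A) (ℓ : A) (hqp : IsQuadraticPair F A T σ ℓ)
    (haniso : ¬ QPIsotropic F A T σ ℓ)
    -- an étale quadratic F-algebra K = F[u], u² = u + a, with separable minimal polynomial
    (K : Type) [CommRing K] [Algebra F K] (hK2 : Module.finrank F K = 2)
    (u : K) (a : F) (hu : u * u = u + algebraMap F K a)
    (hugen : u ∉ Set.range (algebraMap F K)) (ha : (1 : F) + 4 * a ≠ 0)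
    -- the reduced trace of A_K is the base change of T
    (TK : K ⊗[F] A →ₗ[K] K)
    (hTK : ∀ (c : K) (x : A), TK (c ⊗ₜ[F] x) = c * algebraMap F K (T x))
    -- (A, σ, f)_K is split and hyperbolic
    (hsplit : IsSplit K (K ⊗[F] A))
    (hhyp : QPHyperbolic K (K ⊗[F] A) TK (LinearMap.baseChange K σ) ((1 : K) ⊗ₜ[F] ℓ)) :
    deg F A ≤ 4 := by
  by_cases hr : ∃ r : F, r * r = r + a
  · obtain ⟨r, hr⟩ := hr
    obtain ⟨I, hI, hIdim⟩ := hhyp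
    have hbot := eq_bot_of_root haniso hTK hI hK2 hu hugen ha hr
    have := hA.2.1
    have := hA.2.2
    have : Nontrivial K := ⟨⟨u, 0, fun h => hugen ⟨0, by rw [h, map_zero]⟩⟩⟩
    have hpos : 0 < Module.finrank F A := Module.finrank_pos
    rw [hbot, Module.finrank_baseChange, finrank_bot] at hIdim
    omega
  · push Not at hr
    let _ : Field K := (isField_of_no_root hK2 hu hugen hr).toField
    exact deg_le_four_of_field F h3 A hA T hT σ ℓ hqp haniso K hK2 u a hu hugen ha TK hTK
      hsplit hhyp

end Triality
end

section
/- Let Q be an F-quaternion algebra with canonical involution can_Q, and let K be an étale quadratic F-algebra contained in Q with nontrivial F-automorphism ι. Pick a generator ℓ of K with ℓ² − ℓ ∈ F and set γ = Int(2ℓ−1) ∘ can_Q (so γ = can_Q if char F = 2, and γ is an orthogonal involution if char F ≠ 2). Then γ acts nontrivially on K, the F-algebra with quadratic pair (Q, γ, f_ℓ) is a quadratic extension of (K, ι), and the discriminant of (γ, f_ℓ) is the class defining the étale quadratic F-algebra K. -/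
/-!  Common definitions for formalizing results of
"Triality over fields with I³ = 0" (F. K. Bingöl, A. Quéguiner-Mathieu).

We model an algebra with quadratic pair `(A, σ, f)` by the data of the reduced trace
`T` of `A` (given together with the property `IsReducedTrace` characterising it via a
splitting field), the involution `σ`, and an element `ℓ ∈ A` with `ℓ + σ(ℓ) = 1`; the
semi-trace is `f = f_ℓ : s ↦ T(ℓ s)`.  By [KMRT, (5.7)] every semi-trace is of this
form, so this is an equivalent description of quadratic pairs.  -/

open scoped TensorProduct
open Module

namespace Triality

section Quaternion

variable {F : Type} [Field F] {Q : Type} [Ring Q] [Algebra F Q]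

theorem IsInvolution.map_one {σ : Q →ₗ[F] Q} (hσ : IsInvolution F σ) : σ 1 = 1 := by
  have h := hσ.1 (σ 1) 1
  rwa [mul_one, hσ.2, mul_one, eq_comm] at h

/-- Polarised quadratic equation satisfied by elements of an algebra with an involution
such that `x + can x` is a scalar. -/
theorem mul_add_mul_swap {T : Q →ₗ[F] F} {can : Q →ₗ[F] Q} (hinv : IsInvolution F can)
    (hcan : ∀ x : Q, x + can x = algebraMap F Q (T x)) (x y : Q) :
    x * y + y * x = T x • y + T y • x + (T (y * x) - T x * T y) • (1 : Q) := by
  have hc : ∀ z : Q, can z = T z • (1 : Q) - z := fun z => by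
    rw [← Algebra.algebraMap_eq_smul_one, ← hcan z, add_sub_cancel_left]
  have h := hinv.1 y x
  rw [hc, hc, hc] at h
  simp only [mul_sub, sub_mul, smul_mul_assoc, mul_smul_comm, one_mul, mul_one, smul_sub,
    smul_smul] at h
  rw [sub_smul, sub_eq_iff_eq_add.mp h]
  module

/-- The trace of a non-scalar element `ℓ` with `ℓ² - ℓ` a scalar is `1`. -/
theorem trace_eq_one [Algebra.IsCentral F Q] {T : Q →ₗ[F] F} {can : Q →ₗ[F] Q}
    (hinv : IsInvolution F can) (hcan : ∀ x : Q, x + can x = algebraMap F Q (T x))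
    {ℓ : Q} {a : F} (hl : ℓ * ℓ = ℓ + algebraMap F Q a)
    (hlgen : ℓ ∉ Set.range (algebraMap F Q)) : T ℓ = 1 := by
  by_contra hne
  refine hlgen ?_
  have hmem : ℓ ∈ Subalgebra.center F Q := by
    rw [Subalgebra.mem_center_iff]
    intro y
    have h := mul_add_mul_swap hinv hcan ℓ y
    have h1 : ℓ * (ℓ * y + y * ℓ) - (ℓ * y + y * ℓ) * ℓ = T ℓ • (ℓ * y - y * ℓ) := by
      rw [h]
      simp only [mul_add, add_mul, smul_mul_assoc, mul_smul_comm, one_mul, mul_one]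
      module
    have h2 : ℓ * (ℓ * y + y * ℓ) - (ℓ * y + y * ℓ) * ℓ = ℓ * y - y * ℓ := by
      have : ℓ * (ℓ * y + y * ℓ) - (ℓ * y + y * ℓ) * ℓ = ℓ * ℓ * y - y * (ℓ * ℓ) := by
        noncomm_ring
      rw [this, hl, add_mul, mul_add, ← Algebra.commutes a y]
      abel
    have h3 : (T ℓ - 1) • (ℓ * y - y * ℓ) = 0 := by
      rw [sub_smul, one_smul, ← h1, h2, sub_self]
    rcases smul_eq_zero.mp h3 with h4 | h4
    · exact absurd (sub_eq_zero.mp h4) hne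
    · exact (sub_eq_zero.mp h4).symm
  rw [Algebra.IsCentral.center_eq_bot] at hmem
  exact Algebra.mem_bot.mp hmem

/-- The orthogonal of `F[ℓ]` for the bilinear form `(x, y) ↦ T (x * y)`. -/
def traceOrth (T : Q →ₗ[F] F) (ℓ : Q) : Submodule F Q :=
  LinearMap.ker (T.prod (T ∘ₗ LinearMap.mulLeft F ℓ))

theorem mem_traceOrth {T : Q →ₗ[F] F} {ℓ v : Q} :
    v ∈ traceOrth T ℓ ↔ T v = 0 ∧ T (ℓ * v) = 0 := by
  simp [traceOrth]

theorem mul_eq_of_mem_traceOrth {T : Q →ₗ[F] F} {can : Q →ₗ[F] Q}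
    (hinv : IsInvolution F can) (hcan : ∀ x : Q, x + can x = algebraMap F Q (T x))
    {ℓ v : Q} (hTl : T ℓ = 1) (hv : v ∈ traceOrth T ℓ) : v * ℓ = v - ℓ * v := by
  rw [mem_traceOrth] at hv
  have h := mul_add_mul_swap hinv hcan v ℓ
  rw [hv.1, hv.2, hTl] at h
  simp only [zero_smul, one_smul, zero_mul, sub_zero, add_zero, zero_add] at h
  exact eq_sub_of_add_eq h

theorem pair_independent {ℓ : Q} (hlgen : ℓ ∉ Set.range (algebraMap F Q)) {c d : F}
    (h : c • (1 : Q) + d • ℓ = 0) : c = 0 ∧ d = 0 := by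
  have : Nontrivial Q := ⟨ℓ, algebraMap F Q 0, fun h => hlgen ⟨0, h.symm⟩⟩
  have hd : d = 0 := by
    by_contra hd
    refine hlgen ⟨-(d⁻¹ * c), ?_⟩
    have h1 : ℓ = d⁻¹ • (d • ℓ) := by rw [smul_smul, inv_mul_cancel₀ hd, one_smul]
    rw [h1, eq_neg_of_add_eq_zero_right h, Algebra.algebraMap_eq_smul_one]
    module
  subst hd
  simpa using h

theorem finrank_span_pair {ℓ : Q} (hlgen : ℓ ∉ Set.range (algebraMap F Q)) :
    Module.finrank F (Submodule.span F ({1, ℓ} : Set Q)) = 2 := by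
  have hli : LinearIndependent F ![(1 : Q), ℓ] :=
    LinearIndependent.pair_iff.mpr fun _ _ h => pair_independent hlgen h
  have h := finrank_span_eq_card hli
  rwa [Matrix.range_cons_cons_empty, Fintype.card_fin] at h

theorem disjoint_span_traceOrth {T : Q →ₗ[F] F} {ℓ : Q} {a : F}
    (hl : ℓ * ℓ = ℓ + algebraMap F Q a) (ha : (1 : F) + 4 * a ≠ 0)
    (hT1 : T 1 = 2) (hTl : T ℓ = 1) :
    Disjoint (Submodule.span F ({1, ℓ} : Set Q)) (traceOrth T ℓ) := by
  rw [Submodule.disjoint_def]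
  intro x hx hxV
  obtain ⟨c, d, rfl⟩ := Submodule.mem_span_pair.mp hx
  rw [mem_traceOrth] at hxV
  obtain ⟨h1, h2⟩ := hxV
  simp only [mul_add, mul_smul_comm, mul_one, hl, map_add, map_smul, hT1, hTl, smul_eq_mul,
    Algebra.algebraMap_eq_smul_one] at h1 h2
  have hc : c * (1 + 4 * a) = 0 := by linear_combination (1 + 2 * a) * h1 - h2
  obtain rfl : c = 0 := (mul_eq_zero.mp hc).resolve_right ha
  obtain rfl : d = 0 := by simpa using h1
  simp

theorem finrank_traceOrth_ge [Module.Finite F Q] (hdim : Module.finrank F Q = 4)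
    (T : Q →ₗ[F] F) (ℓ : Q) : 2 ≤ Module.finrank F (traceOrth T ℓ) := by
  have h := LinearMap.finrank_range_add_finrank_ker (T.prod (T ∘ₗ LinearMap.mulLeft F ℓ))
  have h2 := Submodule.finrank_le (LinearMap.range (T.prod (T ∘ₗ LinearMap.mulLeft F ℓ)))
  rw [Module.finrank_prod, Module.finrank_self] at h2
  change _ + Module.finrank F (traceOrth T ℓ) = _ at h
  omega

theorem isCompl_span_traceOrth [Module.Finite F Q] (hdim : Module.finrank F Q = 4)
    {T : Q →ₗ[F] F} {ℓ : Q} {a : F} (hl : ℓ * ℓ = ℓ + algebraMap F Q a)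
    (hlgen : ℓ ∉ Set.range (algebraMap F Q)) (ha : (1 : F) + 4 * a ≠ 0)
    (hT1 : T 1 = 2) (hTl : T ℓ = 1) :
    IsCompl (Submodule.span F ({1, ℓ} : Set Q)) (traceOrth T ℓ) := by
  have hd := disjoint_span_traceOrth hl ha hT1 hTl
  refine ⟨hd, ?_⟩
  have h := Submodule.finrank_add_finrank_le_of_disjoint hd
  have h2 := finrank_traceOrth_ge hdim T ℓ
  have h3 := finrank_span_pair hlgen
  rw [codisjoint_iff]
  refine Submodule.eq_top_of_disjoint _ _ ?_ hd
  omega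

theorem finrank_traceOrth [Module.Finite F Q] (hdim : Module.finrank F Q = 4)
    {T : Q →ₗ[F] F} {ℓ : Q} {a : F} (hl : ℓ * ℓ = ℓ + algebraMap F Q a)
    (hlgen : ℓ ∉ Set.range (algebraMap F Q)) (ha : (1 : F) + 4 * a ≠ 0)
    (hT1 : T 1 = 2) (hTl : T ℓ = 1) : Module.finrank F (traceOrth T ℓ) = 2 := by
  have h := Submodule.finrank_add_finrank_le_of_disjoint
    (disjoint_span_traceOrth hl ha hT1 hTl)
  have h2 := finrank_traceOrth_ge hdim T ℓ
  have h3 := finrank_span_pair hlgen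
  omega

theorem exists_eq_add {T : Q →ₗ[F] F} {ℓ : Q}
    (h : IsCompl (Submodule.span F ({1, ℓ} : Set Q)) (traceOrth T ℓ)) (x : Q) :
    ∃ c d : F, ∃ v ∈ traceOrth T ℓ, x = c • (1 : Q) + d • ℓ + v := by
  have hx : x ∈ Submodule.span F ({1, ℓ} : Set Q) ⊔ traceOrth T ℓ := by
    rw [h.sup_eq_top]; trivial
  obtain ⟨k, hk, v, hv, rfl⟩ := Submodule.mem_sup.mp hx
  obtain ⟨c, d, rfl⟩ := Submodule.mem_span_pair.mp hk
  exact ⟨c, d, v, hv, rfl⟩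

theorem sq_two_mul_sub_one {ℓ : Q} {a : F} (hl : ℓ * ℓ = ℓ + algebraMap F Q a) :
    (ℓ + ℓ - 1) * (ℓ + ℓ - 1) = ((1 : F) + 4 * a) • (1 : Q) := by
  have : (ℓ + ℓ - 1) * (ℓ + ℓ - 1) = 4 * (ℓ * ℓ) - 4 * ℓ + 1 := by noncomm_ring
  rw [this, hl, Algebra.algebraMap_eq_smul_one, mul_add, add_smul, mul_smul, one_smul,
    ofNat_smul_eq_nsmul, nsmul_eq_mul]
  push_cast
  abel

theorem two_mul_sub_one_mul_cancel {ℓ : Q} {a : F} (hl : ℓ * ℓ = ℓ + algebraMap F Q a)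
    (ha : (1 : F) + 4 * a ≠ 0) {x : Q} (h : (ℓ + ℓ - 1) * x = 0) : x = 0 := by
  have h1 : ((1 : F) + 4 * a) • x = 0 := by
    rw [← one_mul x, ← smul_mul_assoc, ← sq_two_mul_sub_one hl, mul_assoc, h, mul_zero]
  exact (smul_eq_zero.mp h1).resolve_left ha

/-- If `v ℓ = (1 - ℓ) v` and `v` commutes with `ℓ`, then `v = 0`. -/
theorem eq_zero_of_commute {ℓ v : Q} {a : F} (hl : ℓ * ℓ = ℓ + algebraMap F Q a)
    (ha : (1 : F) + 4 * a ≠ 0) (hv : v * ℓ = v - ℓ * v) (hc : v * ℓ = ℓ * v) : v = 0 := by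
  apply two_mul_sub_one_mul_cancel hl ha
  rw [sub_mul, add_mul, one_mul, sub_eq_zero]
  rw [hc] at hv
  exact eq_sub_iff_add_eq.mp hv

/-- The `F[ℓ]`-linear projection of `Q` onto the centralizer of `ℓ`. -/
def centProj (ℓ : Q) (a : F) : Q →ₗ[F] Q :=
  LinearMap.id - ((1 : F) + 4 * a)⁻¹ • LinearMap.mulLeft F (ℓ + ℓ - 1) ∘ₗ
    (LinearMap.mulLeft F ℓ - LinearMap.mulRight F ℓ)

theorem centProj_apply (ℓ : Q) (a : F) (x : Q) : centProj ℓ a x =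
    x - ((1 : F) + 4 * a)⁻¹ • ((ℓ + ℓ - 1) * (ℓ * x - x * ℓ)) := by
  simp [centProj]

theorem centProj_of_commute {ℓ : Q} (a : F) {x : Q} (hx : x * ℓ = ℓ * x) :
    centProj ℓ a x = x := by
  simp [centProj_apply, hx]

theorem centProj_of_anti {ℓ x : Q} {a : F} (hl : ℓ * ℓ = ℓ + algebraMap F Q a)
    (ha : (1 : F) + 4 * a ≠ 0) (hx : x * ℓ = x - ℓ * x) : centProj ℓ a x = 0 := by
  have h : ℓ * x - x * ℓ = (ℓ + ℓ - 1) * x := by rw [hx]; noncomm_ring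
  rw [centProj_apply, h, ← mul_assoc, sq_two_mul_sub_one hl, smul_mul_assoc, one_mul,
    smul_smul, inv_mul_cancel₀ ha, one_smul, sub_self]

/-- The identity behind the second family of relations of the Clifford algebra. -/
theorem centProj_mul_centProj {ℓ p q v w : Q} {a : F} (hl : ℓ * ℓ = ℓ + algebraMap F Q a)
    (ha : (1 : F) + 4 * a ≠ 0) (hp : p * ℓ = ℓ * p) (hq : q * ℓ = ℓ * q)
    (hv : v * ℓ = v - ℓ * v) (hw : w * ℓ = w - ℓ * w) :
    centProj ℓ a (p + v) * centProj ℓ a (q + w) = centProj ℓ a ((p + v) * ℓ * (q + w)) +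
      ((1 : F) + 4 * a)⁻¹ •
        (centProj ℓ a ((p + v) * (ℓ + ℓ - 1) * (q + w)) * ((ℓ + ℓ - 1) * (1 - ℓ))) := by
  have hvw : v * w * ℓ = ℓ * (v * w) := by
    rw [mul_assoc, hw, mul_sub, ← mul_assoc v ℓ, hv]; noncomm_ring
  have hpq : p * q * ℓ = ℓ * (p * q) := by rw [mul_assoc, hq, ← mul_assoc, hp, mul_assoc]
  have hpw : p * w * ℓ = p * w - ℓ * (p * w) := by
    rw [mul_assoc, hw, mul_sub, ← mul_assoc p ℓ, hp, mul_assoc]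
  have hvq : v * q * ℓ = v * q - ℓ * (v * q) := by
    rw [mul_assoc, hq, ← mul_assoc, hv, sub_mul, mul_assoc]
  have comm_l : ∀ {x : Q}, x * ℓ = ℓ * x → ℓ * x * ℓ = ℓ * (ℓ * x) := fun h => by
    rw [mul_assoc, h]
  have anti_l : ∀ {x : Q}, x * ℓ = x - ℓ * x → ℓ * x * ℓ = ℓ * x - ℓ * (ℓ * x) := fun h => by
    rw [mul_assoc, h, mul_sub]
  have e1 : (p + v) * ℓ * (q + w) =
      ℓ * (p * q) + ℓ * (p * w) + (v * q - ℓ * (v * q)) + (v * w - ℓ * (v * w)) := by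
    rw [add_mul, hp, hv]; noncomm_ring
  have π1 : centProj ℓ a ((p + v) * ℓ * (q + w)) = ℓ * (p * q) + (v * w - ℓ * (v * w)) := by
    rw [e1]
    simp only [map_add, map_sub]
    rw [centProj_of_commute a (comm_l hpq), centProj_of_anti hl ha (anti_l hpw),
      centProj_of_anti hl ha hvq, centProj_of_anti hl ha (anti_l hvq),
      centProj_of_commute a hvw, centProj_of_commute a (comm_l hvw)]
    abel
  have π2 : centProj ℓ a ((p + v) * (q + w)) = p * q + v * w := by
    rw [add_mul, mul_add, mul_add]
    simp only [map_add]
    rw [centProj_of_commute a hpq, centProj_of_anti hl ha hpw, centProj_of_anti hl ha hvq,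
      centProj_of_commute a hvw]
    abel
  have π3 : centProj ℓ a ((p + v) * (ℓ + ℓ - 1) * (q + w)) =
      (p * q - v * w) * (ℓ + ℓ - 1) := by
    have : (p + v) * (ℓ + ℓ - 1) * (q + w) =
      (p + v) * ℓ * (q + w) + (p + v) * ℓ * (q + w) - (p + v) * (q + w) := by noncomm_ring
    rw [this, map_sub, map_add, π1, π2, mul_sub, mul_add, sub_mul, hpq, hvw]
    noncomm_ring
  rw [π1, π3, mul_assoc, ← mul_assoc (ℓ + ℓ - 1), sq_two_mul_sub_one hl, smul_mul_assoc,
    one_mul, mul_smul_comm, smul_smul, inv_mul_cancel₀ ha, one_smul, map_add, map_add,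
    centProj_of_commute a hp, centProj_of_commute a hq, centProj_of_anti hl ha hv,
    centProj_of_anti hl ha hw, mul_sub, mul_one, sub_mul, hpq, hvw]
  noncomm_ring


theorem centralizer_eq_adjoin {T : Q →ₗ[F] F} {ℓ : Q} {a : F}
    (hl : ℓ * ℓ = ℓ + algebraMap F Q a) (ha : (1 : F) + 4 * a ≠ 0)
    (hcompl : IsCompl (Submodule.span F ({1, ℓ} : Set Q)) (traceOrth T ℓ))
    (hV : ∀ v ∈ traceOrth T ℓ, v * ℓ = v - ℓ * v) :
    Subalgebra.centralizer F ({ℓ} : Set Q) = Algebra.adjoin F ({ℓ} : Set Q) := by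
  apply le_antisymm
  · intro x hx
    obtain ⟨c, d, v, hv, rfl⟩ := exists_eq_add hcompl x
    have hcomm : v * ℓ = ℓ * v := by
      have := Subalgebra.mem_centralizer_iff F |>.mp hx ℓ rfl
      simpa [mul_add, add_mul, eq_comm] using this
    rw [eq_zero_of_commute hl ha (hV v hv) hcomm, add_zero]
    exact add_mem (Subalgebra.smul_mem _ (one_mem _) c)
      (Subalgebra.smul_mem _ (Algebra.self_mem_adjoin_singleton F ℓ) d)
  · rw [Algebra.adjoin_le_iff]
    rintro x rfl
    rw [SetLike.mem_coe, Subalgebra.mem_centralizer_iff]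
    rintro _ rfl
    rfl

section Involution

variable {T : Q →ₗ[F] F} {can γ : Q →ₗ[F] Q} {ℓ : Q} {a : F}

theorem isInvolution_conj (hinv : IsInvolution F can) (hl : ℓ * ℓ = ℓ + algebraMap F Q a)
    (ha : (1 : F) + 4 * a ≠ 0) (hcl : can ℓ = 1 - ℓ)
    (hγ : ∀ x : Q, ((1 : F) + 4 * a) • γ x = (ℓ + ℓ - 1) * can x * (ℓ + ℓ - 1)) :
    IsInvolution F γ := by
  have hu := sq_two_mul_sub_one hl
  have hcu : can (ℓ + ℓ - 1) = -(ℓ + ℓ - 1) := by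
    rw [map_sub, map_add, hcl, hinv.map_one]; abel
  have hγ' : ∀ x, γ x = ((1 : F) + 4 * a)⁻¹ • ((ℓ + ℓ - 1) * can x * (ℓ + ℓ - 1)) :=
    fun x => by rw [← hγ, smul_smul, inv_mul_cancel₀ ha, one_smul]
  refine ⟨fun x y => ?_, fun x => ?_⟩
  · have : (ℓ + ℓ - 1) * can y * (ℓ + ℓ - 1) * ((ℓ + ℓ - 1) * can x * (ℓ + ℓ - 1)) =
        (ℓ + ℓ - 1) * can y * ((ℓ + ℓ - 1) * (ℓ + ℓ - 1)) * (can x * (ℓ + ℓ - 1)) := by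
      simp only [mul_assoc]
    rw [hγ', hγ', hγ', smul_mul_smul_comm, this, hu, hinv.1, mul_smul_comm, mul_one,
      smul_mul_assoc, smul_smul, mul_assoc ((1 + 4 * a)⁻¹), inv_mul_cancel₀ ha, mul_one]
    simp only [mul_assoc]
  · have : (ℓ + ℓ - 1) * (-(ℓ + ℓ - 1) * (x * -(ℓ + ℓ - 1))) * (ℓ + ℓ - 1) =
        (ℓ + ℓ - 1) * (ℓ + ℓ - 1) * x * ((ℓ + ℓ - 1) * (ℓ + ℓ - 1)) := by
      simp only [mul_assoc, neg_mul, mul_neg, neg_neg]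
    rw [hγ', hγ' x, map_smul, hinv.1, hinv.1, hcu, hinv.2, mul_smul_comm, smul_mul_assoc,
      this, hu, smul_mul_assoc, one_mul, mul_smul_comm, mul_one, smul_smul, smul_smul,
      smul_smul]
    rw [inv_mul_cancel_right₀ ha, inv_mul_cancel₀ ha, one_smul]

theorem conj_self (hl : ℓ * ℓ = ℓ + algebraMap F Q a) (ha : (1 : F) + 4 * a ≠ 0)
    (hcl : can ℓ = 1 - ℓ)
    (hγ : ∀ x : Q, ((1 : F) + 4 * a) • γ x = (ℓ + ℓ - 1) * can x * (ℓ + ℓ - 1)) :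
    γ ℓ = 1 - ℓ := by
  apply smul_right_injective Q ha
  have : (ℓ + ℓ - 1) * (1 - ℓ) * (ℓ + ℓ - 1) = (ℓ + ℓ - 1) * (ℓ + ℓ - 1) * (1 - ℓ) := by
    noncomm_ring
  simp only
  rw [hγ, hcl, this, sq_two_mul_sub_one hl, smul_mul_assoc, one_mul]

theorem conj_eq_self_of_mem_traceOrth (hl : ℓ * ℓ = ℓ + algebraMap F Q a)
    (ha : (1 : F) + 4 * a ≠ 0) (hcan : ∀ x : Q, x + can x = algebraMap F Q (T x))
    (hγ : ∀ x : Q, ((1 : F) + 4 * a) • γ x = (ℓ + ℓ - 1) * can x * (ℓ + ℓ - 1))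
    {v : Q} (hv : v ∈ traceOrth T ℓ) (hvl : v * ℓ = v - ℓ * v) : γ v = v := by
  apply smul_right_injective Q ha
  have hcv : can v = -v := by
    have := hcan v
    rw [(mem_traceOrth.mp hv).1, map_zero] at this
    exact eq_neg_of_add_eq_zero_right this
  have h1 : -v * (ℓ + ℓ - 1) = (ℓ + ℓ - 1) * v := by
    rw [neg_mul, mul_sub, mul_add, hvl]; noncomm_ring
  simp only
  rw [hγ, hcv, mul_assoc, h1, ← mul_assoc, sq_two_mul_sub_one hl, smul_mul_assoc, one_mul]

theorem symSet_eq {σ : Q →ₗ[F] Q} (h1 : σ 1 = 1) (hσl : σ ℓ = 1 - ℓ)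
    (hlgen : ℓ ∉ Set.range (algebraMap F Q))
    (hcompl : IsCompl (Submodule.span F ({1, ℓ} : Set Q)) (traceOrth T ℓ))
    (hV : ∀ v ∈ traceOrth T ℓ, σ v = v) :
    symSet F σ = Submodule.span F {1} ⊔ traceOrth T ℓ := by
  have hmem : ∀ x, x ∈ symSet F σ ↔ σ x = x := fun x => by
    simp [symSet, sub_eq_zero]
  apply le_antisymm
  · intro x hx
    rw [hmem] at hx
    obtain ⟨c, d, v, hv, rfl⟩ := exists_eq_add hcompl x
    have h2 : d • (1 : Q) + (-(2 * d)) • ℓ = 0 := by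
      simp only [map_add, map_smul, h1, hσl, hV v hv] at hx
      rw [← sub_eq_zero] at hx
      rw [← hx]
      module
    rw [(pair_independent hlgen h2).1, zero_smul, add_zero]
    exact Submodule.add_mem_sup (Submodule.smul_mem _ _ (Submodule.mem_span_singleton_self 1)) hv
  · refine sup_le ?_ fun v hv => (hmem v).mpr (hV v hv)
    rw [Submodule.span_le, Set.singleton_subset_iff]
    exact (hmem 1).mpr h1

theorem finrank_symSet [Module.Finite F Q] {σ : Q →ₗ[F] Q} (h1 : σ 1 = 1)
    (hσl : σ ℓ = 1 - ℓ) (hlgen : ℓ ∉ Set.range (algebraMap F Q))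
    (hcompl : IsCompl (Submodule.span F ({1, ℓ} : Set Q)) (traceOrth T ℓ))
    (hV : ∀ v ∈ traceOrth T ℓ, σ v = v) (hrank : Module.finrank F (traceOrth T ℓ) = 2) :
    Module.finrank F (symSet F σ) = 3 := by
  have : Nontrivial Q := ⟨ℓ, algebraMap F Q 0, fun h => hlgen ⟨0, h.symm⟩⟩
  have hd : Submodule.span F {(1 : Q)} ⊓ traceOrth T ℓ = ⊥ :=
    (hcompl.disjoint.mono_left (Submodule.span_mono (by simp))).eq_bot
  have h := Submodule.finrank_sup_add_finrank_inf_eq (Submodule.span F {(1 : Q)})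
    (traceOrth T ℓ)
  rw [hd, finrank_bot, hrank, finrank_span_singleton (one_ne_zero (α := Q)),
    ← symSet_eq h1 hσl hlgen hcompl hV] at h
  exact h

theorem trace_eq_zero_of_skew {σ : Q →ₗ[F] Q} (h1 : σ 1 = 1) (hσl : σ ℓ = 1 - ℓ)
    (hT1 : T 1 = 2) (hTl : T ℓ = 1)
    (hcompl : IsCompl (Submodule.span F ({1, ℓ} : Set Q)) (traceOrth T ℓ))
    (hV : ∀ v ∈ traceOrth T ℓ, σ v = v) {x : Q} (hx : σ x = -x) : T x = 0 := by
  obtain ⟨c, d, v, hv, rfl⟩ := exists_eq_add hcompl x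
  have h2 : (2 * c + d) • (1 : Q) + (2 : F) • v = 0 := by
    simp only [map_add, map_smul, h1, hσl, hV v hv] at hx
    rw [eq_neg_iff_add_eq_zero] at hx
    rw [← hx]
    module
  have hTv := mem_traceOrth.mp hv
  have h3 := congrArg (fun y => T (ℓ * y)) h2
  simp only [mul_add, mul_smul_comm, mul_one, map_add, map_smul, hTl, hTv.2, mul_zero,
    map_zero, smul_eq_mul, add_zero] at h3
  simp only [map_add, map_smul, hT1, hTl, hTv.1, smul_eq_mul]
  linear_combination h3

end Involution

section Clifford

variable {T : Q →ₗ[F] F} {σ : Q →ₗ[F] Q} {ℓ : Q} {a : F}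

theorem sand_tmul (p q x : Q) : sand F Q (p ⊗ₜ[F] q) x = p * x * q := by
  simp [sand]

theorem mu2_tmul (p q : Q) :
    mu2 F Q (p ⊗ₜ[F] q) = TensorAlgebra.ι F p * TensorAlgebra.ι F q := by
  simp [mu2]

theorem cliffGen_add (x y : Q) :
    cliffGen F Q T σ ℓ (x + y) = cliffGen F Q T σ ℓ x + cliffGen F Q T σ ℓ y := by
  simp only [cliffGen, map_add]; rfl

theorem cliffGen_smul (c : F) (x : Q) :
    cliffGen F Q T σ ℓ (c • x) = c • cliffGen F Q T σ ℓ x := by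
  simp only [cliffGen, map_smul]; rfl

theorem cliffGen_of_sym {s : Q} (hs : σ s = s) :
    cliffGen F Q T σ ℓ s = T (ℓ * s) • (1 : CliffordAlg F Q T σ ℓ) := by
  have h := RingQuot.mkAlgHom_rel F (CliffordRel.sym (F := F) (T := T) (σ := σ) (ℓ := ℓ) s hs)
  rw [AlgHom.commutes] at h
  exact h.trans (Algebra.algebraMap_eq_smul_one (A := CliffordAlg F Q T σ ℓ) _)

theorem lift_centProj_mu2 {T : Q →ₗ[F] F} (hl : ℓ * ℓ = ℓ + algebraMap F Q a)
    (ha : (1 : F) + 4 * a ≠ 0)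
    (hcompl : IsCompl (Submodule.span F ({1, ℓ} : Set Q)) (traceOrth T ℓ))
    (hV : ∀ v ∈ traceOrth T ℓ, v * ℓ = v - ℓ * v) (c : Q ⊗[F] Q) :
    TensorAlgebra.lift F (centProj ℓ a) (mu2 F Q c) =
      centProj ℓ a (sand F Q c ℓ) + ((1 : F) + 4 * a)⁻¹ •
        (centProj ℓ a (sand F Q c (ℓ + ℓ - 1)) * ((ℓ + ℓ - 1) * (1 - ℓ))) := by
  induction c using TensorProduct.induction_on with
  | zero => simp
  | add x y hx hy =>
    simp only [map_add, LinearMap.add_apply] at hx hy ⊢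
    rw [hx, hy, add_mul, smul_add]
    abel
  | tmul x y =>
    obtain ⟨c, d, v, hv, rfl⟩ := exists_eq_add hcompl x
    obtain ⟨c', d', w, hw, rfl⟩ := exists_eq_add hcompl y
    rw [mu2_tmul, map_mul, TensorAlgebra.lift_ι_apply, TensorAlgebra.lift_ι_apply, sand_tmul,
      sand_tmul]
    exact centProj_mul_centProj hl ha (by simp [add_mul, mul_add]) (by simp [add_mul, mul_add])
      (hV v hv) (hV w hw)

theorem lift_centProj_rel (hl : ℓ * ℓ = ℓ + algebraMap F Q a) (ha : (1 : F) + 4 * a ≠ 0)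
    (h1 : σ 1 = 1) (hσl : σ ℓ = 1 - ℓ) (hlgen : ℓ ∉ Set.range (algebraMap F Q))
    (hTl : T ℓ = 1)
    (hcompl : IsCompl (Submodule.span F ({1, ℓ} : Set Q)) (traceOrth T ℓ))
    (hV : ∀ v ∈ traceOrth T ℓ, v * ℓ = v - ℓ * v) (hσV : ∀ v ∈ traceOrth T ℓ, σ v = v)
    {x y : TensorAlgebra F Q} (hxy : CliffordRel F Q T σ ℓ x y) :
    TensorAlgebra.lift F (centProj ℓ a) x = TensorAlgebra.lift F (centProj ℓ a) y := by
  cases hxy with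
  | sym s hs =>
    have hs' : s ∈ symSet F σ := by simp [symSet, hs]
    rw [symSet_eq h1 hσl hlgen hcompl hσV] at hs'
    obtain ⟨k, hk, v, hv, rfl⟩ := Submodule.mem_sup.mp hs'
    obtain ⟨c, rfl⟩ := Submodule.mem_span_singleton.mp hk
    rw [TensorAlgebra.lift_ι_apply, AlgHom.commutes, map_add, centProj_of_anti hl ha (hV v hv),
      centProj_of_commute a (by simp), mul_add, map_add, (mem_traceOrth.mp hv).2,
      mul_smul_comm, mul_one, map_smul, hTl, Algebra.algebraMap_eq_smul_one]
    simp
  | deg2 c hc =>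
    have hu : sand F Q c (ℓ + ℓ - 1) = 0 := by
      have h := hc ℓ
      rw [hσl, ← sub_eq_zero, ← map_sub] at h
      have h' : ℓ + ℓ - 1 = -(1 - ℓ - ℓ) := by abel
      rw [h', map_neg, h, neg_zero]
    rw [lift_centProj_mu2 hl ha hcompl hV, hu, TensorAlgebra.lift_ι_apply]
    simp

theorem cliffGen_mul_self (hl : ℓ * ℓ = ℓ + algebraMap F Q a) (h1 : σ 1 = 1)
    (hσl : σ ℓ = 1 - ℓ) (hTl : T ℓ = 1)
    (hcompl : IsCompl (Submodule.span F ({1, ℓ} : Set Q)) (traceOrth T ℓ))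
    (hσV : ∀ v ∈ traceOrth T ℓ, σ v = v) :
    cliffGen F Q T σ ℓ ℓ * cliffGen F Q T σ ℓ ℓ =
      cliffGen F Q T σ ℓ ℓ + a • (1 : CliffordAlg F Q T σ ℓ) := by
  set c : Q ⊗[F] Q := ℓ ⊗ₜ[F] ℓ - ℓ ⊗ₜ[F] 1 - a • (1 ⊗ₜ[F] 1) with hc
  have hsand : ∀ x, sand F Q c x = ℓ * x * ℓ - ℓ * x - a • x := fun x => by
    simp [hc, sand_tmul]
  have hsl : ∀ x, x * ℓ = ℓ * x → sand F Q c x = 0 := fun x hx => by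
    rw [hsand, mul_assoc, hx, ← mul_assoc, hl, Algebra.algebraMap_eq_smul_one, add_mul,
      smul_mul_assoc, one_mul]
    abel
  have hrel : ∀ x, sand F Q c (σ x) = sand F Q c x := fun x => by
    obtain ⟨r, s, v, hv, rfl⟩ := exists_eq_add hcompl x
    simp only [map_add, map_smul, h1, hσl, hσV v hv, map_sub, hsl 1 (by simp), hsl ℓ rfl]
    simp
  have h := RingQuot.mkAlgHom_rel F
    (CliffordRel.deg2 (F := F) (T := T) (σ := σ) (ℓ := ℓ) c hrel)
  rw [hsl ℓ rfl, hc] at h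
  simp only [map_sub, map_smul, mu2_tmul, map_mul, map_zero] at h
  have hone : cliffGen F Q T σ ℓ 1 = 1 := by
    rw [cliffGen_of_sym h1, mul_one, hTl, one_smul]
  have h' : cliffGen F Q T σ ℓ ℓ * cliffGen F Q T σ ℓ ℓ -
      cliffGen F Q T σ ℓ ℓ * cliffGen F Q T σ ℓ 1 -
      a • (cliffGen F Q T σ ℓ 1 * cliffGen F Q T σ ℓ 1) = 0 := h
  rw [hone, mul_one, mul_one, sub_sub, sub_eq_zero] at h'
  exact h'

theorem exists_cliffordAlg_eq (hl : ℓ * ℓ = ℓ + algebraMap F Q a) (h1 : σ 1 = 1)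
    (hσl : σ ℓ = 1 - ℓ) (hTl : T ℓ = 1)
    (hcompl : IsCompl (Submodule.span F ({1, ℓ} : Set Q)) (traceOrth T ℓ))
    (hσV : ∀ v ∈ traceOrth T ℓ, σ v = v) (z : CliffordAlg F Q T σ ℓ) :
    ∃ r s : F, z = r • (1 : CliffordAlg F Q T σ ℓ) + s • cliffGen F Q T σ ℓ ℓ := by
  have hsq := cliffGen_mul_self hl h1 hσl hTl hcompl hσV
  let π : TensorAlgebra F Q →ₐ[F] CliffordAlg F Q T σ ℓ :=
    RingQuot.mkAlgHom F (CliffordRel F Q T σ ℓ)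
  obtain ⟨t, rfl⟩ : ∃ t, π t = z := RingQuot.mkAlgHom_surjective F _ z
  induction t using TensorAlgebra.induction with
  | algebraMap r => exact ⟨r, 0, by simp [Algebra.algebraMap_eq_smul_one]⟩
  | ι x =>
    change ∃ r s : F, cliffGen F Q T σ ℓ x = _
    obtain ⟨c, d, v, hv, rfl⟩ := exists_eq_add hcompl x
    refine ⟨c, d, ?_⟩
    rw [cliffGen_add, cliffGen_add, cliffGen_smul, cliffGen_smul, cliffGen_of_sym h1,
      cliffGen_of_sym (hσV v hv), (mem_traceOrth.mp hv).2, mul_one, hTl]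
    simp
  | mul x y ihx ihy =>
    obtain ⟨r, s, hx⟩ := ihx
    obtain ⟨r', s', hy⟩ := ihy
    refine ⟨r * r' + s * s' * a, r * s' + s * r' + s * s', ?_⟩
    rw [map_mul, hx, hy]
    simp only [mul_add, add_mul, smul_mul_assoc, mul_smul_comm, one_mul, mul_one, hsq]
    module
  | add x y ihx ihy =>
    obtain ⟨r, s, hx⟩ := ihx
    obtain ⟨r', s', hy⟩ := ihy
    exact ⟨r + r', s + s', by rw [map_add, hx, hy]; module⟩

/-- The Clifford algebra of the quadratic pair `(σ, f_ℓ)` on a quaternion algebra is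
isomorphic to `F[ℓ]`. -/
theorem nonempty_cliffordAlg_equiv (hl : ℓ * ℓ = ℓ + algebraMap F Q a)
    (ha : (1 : F) + 4 * a ≠ 0) (h1 : σ 1 = 1) (hσl : σ ℓ = 1 - ℓ)
    (hlgen : ℓ ∉ Set.range (algebraMap F Q)) (hTl : T ℓ = 1)
    (hcompl : IsCompl (Submodule.span F ({1, ℓ} : Set Q)) (traceOrth T ℓ))
    (hV : ∀ v ∈ traceOrth T ℓ, v * ℓ = v - ℓ * v) (hσV : ∀ v ∈ traceOrth T ℓ, σ v = v) :
    Nonempty (CliffordAlg F Q T σ ℓ ≃ₐ[F] Algebra.adjoin F ({ℓ} : Set Q)) := by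
  let ψ : CliffordAlg F Q T σ ℓ →ₐ[F] Q := RingQuot.liftAlgHom F
    ⟨TensorAlgebra.lift F (centProj ℓ a), fun _ _ hxy =>
      lift_centProj_rel hl ha h1 hσl hlgen hTl hcompl hV hσV hxy⟩
  have hψ : ψ (cliffGen F Q T σ ℓ ℓ) = ℓ := by
    refine (RingQuot.liftAlgHom_mkAlgHom_apply F _ _ _).trans ?_
    rw [TensorAlgebra.lift_ι_apply, centProj_of_commute a rfl]
  have hψ' : ∀ r s : F, ψ (r • (1 : CliffordAlg F Q T σ ℓ) + s • cliffGen F Q T σ ℓ ℓ) =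
      r • (1 : Q) + s • ℓ := fun r s => by
    rw [map_add, map_smul, map_smul, map_one, hψ]
  have hinj : Function.Injective ψ := by
    rw [injective_iff_map_eq_zero]
    intro z hz
    obtain ⟨r, s, rfl⟩ := exists_cliffordAlg_eq hl h1 hσl hTl hcompl hσV z
    rw [hψ'] at hz
    obtain ⟨rfl, rfl⟩ := pair_independent hlgen hz
    simp
  have hrange : ψ.range = Algebra.adjoin F ({ℓ} : Set Q) := by
    apply le_antisymm
    · rintro _ ⟨z, rfl⟩
      obtain ⟨r, s, rfl⟩ := exists_cliffordAlg_eq hl h1 hσl hTl hcompl hσV z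
      change ψ _ ∈ _
      rw [hψ']
      exact add_mem (Subalgebra.smul_mem _ (one_mem _) r)
        (Subalgebra.smul_mem _ (Algebra.self_mem_adjoin_singleton F ℓ) s)
    · rw [Algebra.adjoin_le_iff, Set.singleton_subset_iff]
      exact ⟨_, hψ⟩
  exact ⟨(AlgEquiv.ofInjective ψ hinj).trans (Subalgebra.equivOfEq _ _ hrange)⟩

end Clifford

end Quaternion

/-- Example 3.2 of the paper.  Let `Q` be an `F`-quaternion algebra
with canonical involution `can` (characterised by `x + can x = Trd(x)`), and let
`K = F[ℓ]` be an étale quadratic `F`-algebra contained in `Q`, `ℓ² - ℓ = a ∈ F`.  Set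
`γ = Int(2ℓ - 1) ∘ can`.  Then `γ` acts nontrivially on `K` (`γ ℓ = 1 - ℓ`), the
`F`-algebra with quadratic pair `(Q, γ, f_ℓ)` is a quadratic extension of `(K, ι)`
(the centralizer of `K` in `Q` is `K` itself), and the discriminant of `(γ, f_ℓ)` is
the class defining `K`: the centre of the Clifford algebra is isomorphic to `K`. -/
theorem quaternion_quad_ext (F : Type) [Field F]
    (Q : Type) [Ring Q] [Algebra F Q] (hQ : IsCSA F Q)
    (hdim : Module.finrank F Q = 4)
    (T : Q →ₗ[F] F) (hT : IsReducedTrace F Q T)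
    -- the canonical (quaternion) involution of Q
    (can : Q →ₗ[F] Q) (hcaninv : IsInvolution F can)
    (hcan : ∀ x : Q, x + can x = algebraMap F Q (T x))
    -- the étale quadratic subalgebra K = F[ℓ], ℓ² - ℓ = a
    (ℓ : Q) (a : F) (hl : ℓ * ℓ = ℓ + algebraMap F Q a)
    (hlgen : ℓ ∉ Set.range (algebraMap F Q)) (ha : (1 : F) + 4 * a ≠ 0)
    -- γ = Int(2ℓ-1) ∘ can_Q; note (2ℓ-1)⁻¹ = (1+4a)⁻¹(2ℓ-1)
    (γ : Q →ₗ[F] Q)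
    (hγ : ∀ x : Q, ((1 : F) + 4 * a) • γ x = (ℓ + ℓ - 1) * can x * (ℓ + ℓ - 1)) :
    γ ℓ = 1 - ℓ ∧
    IsQuadraticPair F Q T γ ℓ ∧
    Subalgebra.centralizer F ({ℓ} : Set Q) = Algebra.adjoin F ({ℓ} : Set Q) ∧
    Nonempty ((Subalgebra.center F (CliffordAlg F Q T γ ℓ)) ≃ₐ[F]
      (Algebra.adjoin F ({ℓ} : Set Q))) := by
  obtain ⟨hcentral, -, hfin⟩ := hQ
  have : Nontrivial Q := ⟨ℓ, algebraMap F Q 0, fun h => hlgen ⟨0, h.symm⟩⟩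
  have hTl : T ℓ = 1 := trace_eq_one hcaninv hcan hl hlgen
  have hcl : can ℓ = 1 - ℓ := by
    rw [eq_sub_iff_add_eq, add_comm, hcan, hTl, map_one]
  have hT1 : T 1 = 2 := by
    apply FaithfulSMul.algebraMap_injective F Q
    rw [← hcan, hcaninv.map_one, one_add_one_eq_two, map_ofNat]
  have hV : ∀ v ∈ traceOrth T ℓ, v * ℓ = v - ℓ * v := fun v hv =>
    mul_eq_of_mem_traceOrth hcaninv hcan hTl hv
  have hγV : ∀ v ∈ traceOrth T ℓ, γ v = v := fun v hv =>
    conj_eq_self_of_mem_traceOrth hl ha hcan hγ hv (hV v hv)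
  have hcompl := isCompl_span_traceOrth hdim hl hlgen ha hT1 hTl
  have hγinv := isInvolution_conj hcaninv hl ha hcl hγ
  have hγl := conj_self hl ha hcl hγ
  refine ⟨hγl, ⟨hγinv, ?_, fun x hx => ?_, ?_⟩, ?_, ?_⟩
  · have hdeg : deg F Q = 2 := by
      rw [deg, hdim]
      exact Nat.sqrt_eq 2
    rw [hdeg, finrank_symSet hγinv.map_one hγl hlgen hcompl hγV
      (finrank_traceOrth hdim hl hlgen ha hT1 hTl)]
  · exact trace_eq_zero_of_skew hγinv.map_one hγl hT1 hTl hcompl hγV hx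
  · rw [hγl, add_sub_cancel]
  · exact centralizer_eq_adjoin hl ha hcompl hV
  · obtain ⟨e⟩ := nonempty_cliffordAlg_equiv hl ha hγinv.map_one hγl hlgen hTl hcompl hV hγV
    have hcenter : Subalgebra.center F (CliffordAlg F Q T γ ℓ) = ⊤ := by
      rw [eq_top_iff]
      intro z _
      rw [Subalgebra.mem_center_iff]
      intro w
      apply e.injective
      rw [map_mul, map_mul]
      exact mul_comm (e w) (e z)
    exact ⟨((Subalgebra.equivOfEq _ _ hcenter).trans Subalgebra.topEquiv).trans e⟩

end Triality
end

section
/- Let K/F be a separable quadratic field extension with nontrivial F-automorphism ι, let ℓ ∈ K be a generator with ℓ² − ℓ ∈ F, let V be a finite-dimensional K-vector space and h : V × V → K a nonsingular hermitian form over (K, ι). Let q_h : V → F be the trace form, q_h(x) = h(x,x). Then the adjoint algebra with quadratic pair Ad(q_h) = (End_F(V), ad_{q_h}, f_{q_h}) is a quadratic extension of the adjoint algebra with unitary involution Ad(h) = (End_K(V), ad_h); concretely, right multiplication by K embeds K into End_F(V) as an ad_{q_h}-stable subalgebra with centralizer End_K(V), the involution ad_{q_h} restricts to ad_h on End_K(V)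 and to ι on K, and the semi-trace f_{q_h} equals f_ℓ. -/
/-!  Common definitions for formalizing results of
"Triality over fields with I³ = 0" (F. K. Bingöl, A. Quéguiner-Mathieu).

We model an algebra with quadratic pair `(A, σ, f)` by the data of the reduced trace
`T` of `A` (given together with the property `IsReducedTrace` characterising it via a
splitting field), the involution `σ`, and an element `ℓ ∈ A` with `ℓ + σ(ℓ) = 1`; the
semi-trace is `f = f_ℓ : s ↦ T(ℓ s)`.  By [KMRT, (5.7)] every semi-trace is of this
form, so this is an equivalent description of quadratic pairs.  -/

open scoped TensorProduct
open Module

namespace Triality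

/-- A quadratic extension is spanned by `1` and any element outside the base field. -/
theorem exists_eq_add_mul_of_finrank_eq_two {F K : Type*} [Field F] [Field K] [Algebra F K]
    (hK2 : Module.finrank F K = 2) {ℓ : K} (hℓ : ℓ ∉ Set.range (algebraMap F K)) (z : K) :
    ∃ α β : F, z = algebraMap F K α + algebraMap F K β * ℓ := by
  have : Module.Finite F K := Module.finite_of_finrank_pos (by omega)
  have hli : LinearIndependent F ![(1 : K), ℓ] := by
    rw [LinearIndependent.pair_iff' one_ne_zero]
    intro c hc
    exact hℓ ⟨c, by rw [← hc, Algebra.smul_def, mul_one]⟩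
  have hspan := hli.span_eq_top_of_card_eq_finrank' (by simp [hK2])
  have hz : z ∈ Submodule.span F (Set.range ![(1 : K), ℓ]) := hspan ▸ Submodule.mem_top
  rw [Matrix.range_cons_cons_empty, Submodule.mem_span_pair] at hz
  obtain ⟨α, β, rfl⟩ := hz
  exact ⟨α, β, by simp [Algebra.smul_def]⟩

/-- Example 3.3 of the paper.  Let `K/F` be a separable quadratic
field extension with nontrivial automorphism `ι`, `ℓ ∈ K` a generator with
`ℓ² - ℓ = a ∈ F`, `V` a finite-dimensional `K`-vector space and `h` a nonsingular
hermitian form over `(K, ι)` on `V`, with trace form `q_h(x) = h(x,x)`, whose polar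
form is `b(x,y) = h(x,y) + h(y,x)`.  Then `Ad(q_h)` is a quadratic extension of
`Ad(h)`: the `K`-scalar action `μ` on `V` is stable under the adjoint involution
`ad_{q_h}` (the adjoint of `μ_k` is `μ_{ι k}`), its centralizer in `End_F(V)` is
`End_K(V)`, the involution `ad_{q_h}` restricts to `ad_h` on `End_K(V)`, and the
semi-trace `f_{q_h}` (characterised by `f_{q_h}(φ_{q_h}(v ⊗ v)) = q_h(v)`) equals
`f_ℓ = Trd(μ_ℓ ∘ ·)`. -/
theorem adjoint_of_trace_form_is_quad_ext (F : Type) [Field F]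
    (K : Type) [Field K] [Algebra F K] [Algebra.IsSeparable F K]
    (hK2 : Module.finrank F K = 2)
    (ι : K ≃ₐ[F] K) (hι : ι ≠ (AlgEquiv.refl : K ≃ₐ[F] K))
    (ℓ : K) (a : F) (hl : ℓ * ℓ = ℓ + algebraMap F K a)
    (hlgen : ℓ ∉ Set.range (algebraMap F K)) (hιℓ : ι ℓ = 1 - ℓ)
    (V : Type) [AddCommGroup V] [Module K V] [Module F V] [IsScalarTower F K V]
    [FiniteDimensional K V]
    -- a nonsingular hermitian form h over (K, ι)
    (h : V → V → K)
    (hadd : ∀ x x' y : V, h (x + x') y = h x y + h x' y)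
    (hsmul : ∀ (k : K) (x y : V), h (k • x) y = ι k * h x y)
    (hconj : ∀ x y : V, h y x = ι (h x y))
    (hnondeg : ∀ x : V, x ≠ 0 → ∃ y : V, h x y ≠ 0)
    -- μ k is multiplication by the scalar k, as an F-linear endomorphism
    (μ : K → Module.End F V) (hμ : ∀ (k : K) (x : V), μ k x = k • x) :
    -- the image of K in End_F(V) is stable under ad_{q_h}: the adjoint of μ_k is μ_{ι k}
    (∀ (k : K) (x y : V),
      h (k • x) y + h y (k • x) = h x (ι k • y) + h (ι k • y) x) ∧
    -- the centralizer of K in End_F(V) is End_K(V)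
    ((Subalgebra.centralizer F (Set.range μ) : Set (Module.End F V)) =
      Set.range fun φ : V →ₗ[K] V => (φ.restrictScalars F : Module.End F V)) ∧
    -- ad_{q_h} restricts to ad_h on End_K(V)
    (∀ φ ψ : V →ₗ[K] V, (∀ x y : V, h (φ x) y = h x (ψ y)) →
      ∀ x y : V, h (φ x) y + h y (φ x) = h x (ψ y) + h (ψ y) x) ∧
    -- the semi-trace f_{q_h} equals f_ℓ: for P = φ_{q_h}(v ⊗ v), Trd(μ_ℓ ∘ P) = q_h(v)
    (∀ (v : V) (P : Module.End F V), (∀ x : V, P x = (h v x + h x v) • v) →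
      algebraMap F K (LinearMap.trace F V (μ ℓ ∘ₗ P)) = h v v) := by
  have hrep := exists_eq_add_mul_of_finrank_eq_two hK2 hlgen
  have hιι : ∀ z, ι (ι z) = z := by
    intro z
    obtain ⟨α, β, rfl⟩ := hrep z
    simp [hιℓ]
  have hsmulR : ∀ (k : K) (x y : V), h x (k • y) = k * h x y := by
    intro k x y
    rw [hconj (k • y) x, hsmul, map_mul, hιι, ← hconj]
  refine ⟨?_, ?_, ?_, ?_⟩
  · intro k x y
    rw [hsmul, hsmulR, hsmulR, hsmul, hιι]
  · ext T
    simp only [SetLike.mem_coe, Subalgebra.mem_centralizer_iff, Set.mem_range,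
      forall_exists_index, forall_apply_eq_imp_iff]
    constructor
    · intro hT
      refine ⟨{ T with map_smul' := fun k x => ?_ }, rfl⟩
      simpa [hμ] using (LinearMap.congr_fun (hT k) x).symm
    · rintro ⟨φ, rfl⟩ k
      ext x
      simp [hμ]
  · intro φ ψ hφ x y
    rw [hφ, hconj (φ x) y, hφ, hconj x (ψ y)]
  · intro v P hP
    have htr : ∀ x : V, ∃ c : F, algebraMap F K c = h v x + h x v := by
      intro x
      obtain ⟨α, β, hz⟩ := hrep (h v x)
      refine ⟨2 * α + β, ?_⟩
      rw [hconj v x, hz]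
      simp only [map_add, map_mul, AlgEquiv.commutes, hιℓ, map_ofNat]
      ring
    choose t ht using htr
    have haddR : ∀ x y y' : V, h x (y + y') = h x y + h x y' := by
      intro x y y'
      rw [hconj (y + y') x, hadd, map_add, ← hconj, ← hconj]
    let f : V →ₗ[F] F :=
      { toFun := t
        map_add' := fun x y => (algebraMap F K).injective <| by
          rw [map_add, ht, ht, ht, haddR, hadd]
          ring
        map_smul' := fun c x => (algebraMap F K).injective <| by
          rw [RingHom.id_apply, smul_eq_mul, map_mul, ht, ht, ← algebraMap_smul K c x, hsmulR,
            hsmul, AlgEquiv.commutes]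
          ring }
    have hcomp : μ ℓ ∘ₗ P = f.smulRight (ℓ • v) := by
      ext x
      change μ ℓ (P x) = t x • (ℓ • v)
      rw [hμ, hP, ← ht, ← algebraMap_smul K (t x), smul_comm]
    have : Module.Finite F K := Module.finite_of_finrank_pos (by omega)
    have : Module.Finite F V := Module.Finite.trans K V
    rw [hcomp, LinearMap.trace_smulRight]
    change algebraMap F K (t (ℓ • v)) = _
    rw [ht, hsmulR, hsmul, hιℓ]
    ring

end Triality
end

section
/- Let F be a field with I_q^3 F = 0, let K/F be a separable quadratic field extension with nontrivial automorphism ι and norm form N_{K/F}, and let h be a hermitian form over (K, ι) which is adjoint-induced from a nondegenerate non-alternating symmetric bilinear form φ over F (i.e., h has a diagonalization with entries in F given by a diagonalization of φ). Then the trace form q_h of h is isometric to φ ⊗ N_{K/F}; consequently, if dim φ ≥ 3, then h (and hence the unitary involution ad_h) is isotropic, since q_h contains a 6-dimensional subform of a scaled 3-fold quadratic Pfister form, which is isotropic because I_q^3 F = 0. -/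
/-!  Common definitions for formalizing results of
"Triality over fields with I³ = 0" (F. K. Bingöl, A. Quéguiner-Mathieu).

We model an algebra with quadratic pair `(A, σ, f)` by the data of the reduced trace
`T` of `A` (given together with the property `IsReducedTrace` characterising it via a
splitting field), the involution `σ`, and an element `ℓ ∈ A` with `ℓ + σ(ℓ) = 1`; the
semi-trace is `f = f_ℓ : s ↦ T(ℓ s)`.  By [KMRT, (5.7)] every semi-trace is of this
form, so this is an equivalent description of quadratic pairs.  -/

open scoped TensorProduct
open Module

namespace Triality

section QuadraticExtension

variable {F K : Type*} [Field F] [Field K] [Algebra F K]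

theorem isGalois_and_univ_of_finrank_eq_two [FiniteDimensional F K]
    (hK2 : Module.finrank F K = 2) {ι : K ≃ₐ[F] K} (hι : ι ≠ AlgEquiv.refl) :
    IsGalois F K ∧ ∀ σ : K ≃ₐ[F] K, σ = AlgEquiv.refl ∨ σ = ι := by
  classical
  have hle : Fintype.card (K ≃ₐ[F] K) ≤ 2 := hK2 ▸ AlgEquiv.card_le
  have hpair : ({AlgEquiv.refl, ι} : Finset (K ≃ₐ[F] K)).card = 2 := Finset.card_pair hι.symm
  have huniv : ({AlgEquiv.refl, ι} : Finset (K ≃ₐ[F] K)) = Finset.univ :=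
    Finset.eq_univ_of_card _ (le_antisymm (Finset.card_le_univ _) (hpair ▸ hle))
  refine ⟨IsGalois.of_card_aut_eq_finrank F K ?_, fun σ => ?_⟩
  · rw [Nat.card_eq_fintype_card, ← Finset.card_univ, ← huniv, hpair, hK2]
  · have hσ := Finset.mem_univ σ
    rw [← huniv] at hσ
    simpa using hσ

theorem norm_and_trace_of_finrank_eq_two (hK2 : Module.finrank F K = 2)
    {ι : K ≃ₐ[F] K} (hι : ι ≠ AlgEquiv.refl) (x : K) :
    algebraMap F K (Algebra.norm F x) = ι x * x ∧
      algebraMap F K (Algebra.trace F K x) = ι x + x := by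
  classical
  have : FiniteDimensional F K := Module.finite_of_finrank_eq_succ hK2
  obtain ⟨_, hall⟩ := isGalois_and_univ_of_finrank_eq_two hK2 hι
  have huniv : (Finset.univ : Finset (K ≃ₐ[F] K)) = {ι, AlgEquiv.refl} := by
    ext σ
    simpa [or_comm] using hall σ
  constructor
  · rw [Algebra.norm_eq_prod_automorphisms, huniv, Finset.prod_pair hι, AlgEquiv.coe_refl, id]
  · rw [trace_eq_sum_automorphisms, huniv, Finset.sum_pair hι, AlgEquiv.coe_refl, id]

theorem exists_apply_add_self_eq_one (hK2 : Module.finrank F K = 2)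
    {ι : K ≃ₐ[F] K} (hι : ι ≠ AlgEquiv.refl) :
    ∃ θ : K, ι θ + θ = 1 ∧ ι θ ≠ θ := by
  obtain ⟨u, hu⟩ : ∃ u, ι u ≠ u := by
    by_contra! hfix
    exact hι (AlgEquiv.ext hfix)
  have htr := (norm_and_trace_of_finrank_eq_two hK2 hι u).2
  by_cases ht : Algebra.trace F K u = 0
  · have hneg : ι u = -u := by
      rw [ht, map_zero] at htr
      exact eq_neg_of_add_eq_zero_left htr.symm
    have h2 : (2 : K) ≠ 0 := fun h2 => hu (by linear_combination hneg - u * h2)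
    refine ⟨2⁻¹ + u, ?_, fun h => hu ?_⟩
    · simp only [map_add, map_inv₀, map_ofNat, hneg]
      field_simp
      ring
    · rw [map_add, map_inv₀, map_ofNat] at h
      exact add_left_cancel h
  · have ht' : algebraMap F K (Algebra.trace F K u) ≠ 0 := by simpa using ht
    refine ⟨u / algebraMap F K (Algebra.trace F K u), ?_, fun h => hu ?_⟩
    · rw [map_div₀, AlgEquiv.commutes, ← add_div, ← htr, div_self ht']
    · rw [map_div₀, AlgEquiv.commutes] at h
      field_simp at h
      exact h

theorem algebraMap_add_mul_eq_zero {ι : K ≃ₐ[F] K} {θ : K} (hθ : ι θ ≠ θ) {x y : F}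
    (h : algebraMap F K x + algebraMap F K y * θ = 0) : x = 0 ∧ y = 0 := by
  have h' : algebraMap F K x + algebraMap F K y * ι θ = 0 := by
    simpa using congrArg ι h
  have hy : algebraMap F K y = 0 := by
    have : algebraMap F K y * (ι θ - θ) = 0 := by linear_combination h' - h
    exact (mul_eq_zero.mp this).resolve_right (sub_ne_zero.mpr hθ)
  have hx : algebraMap F K x = 0 := by simpa [hy] using h
  exact ⟨by simpa using hx, by simpa using hy⟩

end QuadraticExtension

/-- The six-dimensional subform `⟨1, a, b⟩ ⊗ [1, c]` of a 3-fold Pfister form is isotropic. -/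
theorem I3Trivial.exists_pfister3Form_eq_zero {F : Type} [Field F] (h3 : I3Trivial F)
    {a b c : F} (ha : a ≠ 0) (hb : b ≠ 0) (hc : 1 - 4 * c ≠ 0) :
    ∃ v : Fin 8 → F, v ≠ 0 ∧ v 6 = 0 ∧ v 7 = 0 ∧ pfister3Form F a b c v = 0 := by
  obtain ⟨W, hW, hzero⟩ := h3 a b c ha hb hc
  let p : W →ₗ[F] F × F :=
    ((LinearMap.proj 6).prod (LinearMap.proj 7)).comp W.subtype
  have hker : LinearMap.ker p ≠ ⊥ := LinearMap.ker_ne_bot_of_finrank_lt (by simp [hW])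
  obtain ⟨w, hw, hw0⟩ := Submodule.exists_mem_ne_zero_of_ne_bot hker
  have hw' : w.1 6 = 0 ∧ w.1 7 = 0 := Prod.mk_eq_zero.mp (LinearMap.mem_ker.mp hw)
  exact ⟨w, by simpa using hw0, hw'.1, hw'.2, hzero w w.2⟩

/-- from the proof of Proposition 4.1 of the paper.  Let `F` be a
field with `I_q³F = 0`, `K/F` a separable quadratic field extension with nontrivial
automorphism `ι` and norm `N_{K/F}`, and `h` the hermitian form over `(K, ι)` with
diagonalization `⟨α₁, …, α_m⟩`, `α_i ∈ F^×` (induced by the symmetric bilinear form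
`φ = ⟨α₁, …, α_m⟩` over `F`).  Then the trace form `q_h` is isometric to
`φ ⊗ N_{K/F}`, and if `dim φ ≥ 3` then `h` is isotropic. -/
theorem trace_form_of_induced_hermitian (F : Type) [Field F] (h3 : I3Trivial F)
    (K : Type) [Field K] [Algebra F K] [Algebra.IsSeparable F K]
    (hK2 : Module.finrank F K = 2)
    (ι : K ≃ₐ[F] K) (hι : ι ≠ (AlgEquiv.refl : K ≃ₐ[F] K))
    (m : ℕ) (α : Fin m → F) (hα : ∀ i, α i ≠ 0)
    (h : (Fin m → K) → (Fin m → K) → K)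
    (hdef : ∀ x y : Fin m → K,
      h x y = ∑ i, algebraMap F K (α i) * ι (x i) * y i) :
    (∃ g : (Fin m → K) ≃ₗ[F] (Fin m → K),
      ∀ v : Fin m → K,
        h (g v) (g v) = algebraMap F K (∑ i, α i * Algebra.norm F (v i))) ∧
    (3 ≤ m → ∃ x : Fin m → K, x ≠ 0 ∧ h x x = 0) := by
  refine ⟨⟨LinearEquiv.refl F _, fun v => ?_⟩, fun hm => ?_⟩
  · rw [hdef, map_sum]
    refine Finset.sum_congr rfl fun i _ => ?_
    rw [map_mul, (norm_and_trace_of_finrank_eq_two hK2 hι (v i)).1, LinearEquiv.refl_apply,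
      mul_assoc]
  · obtain ⟨k, rfl⟩ := Nat.exists_eq_add_of_le' hm
    obtain ⟨θ, hθ1, hθ⟩ := exists_apply_add_self_eq_one hK2 hι
    have hN := (norm_and_trace_of_finrank_eq_two hK2 hι θ).1
    set c := Algebra.norm F θ
    have hc : 1 - 4 * c ≠ 0 := fun h0 => by
      have h1 : (ι θ - θ) ^ 2 = 0 := by
        have h2 := congrArg (algebraMap F K) h0
        simp only [map_sub, map_one, map_mul, map_ofNat, map_zero, hN] at h2
        linear_combination h2 + (ι θ + θ + 1) * hθ1
      exact hθ (sub_eq_zero.mp (pow_eq_zero_iff two_ne_zero |>.mp h1))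
    obtain ⟨v, hv, h6, h7, hq⟩ := h3.exists_pfister3Form_eq_zero
      (div_ne_zero (hα 1) (hα 0)) (div_ne_zero (hα 2) (hα 0)) hc
    let z (i j : Fin 8) : K := algebraMap F K (v i) + algebraMap F K (v j) * θ
    have hz (i j : Fin 8) : ι (z i j) * z i j =
        algebraMap F K (v i * v i + v i * v j + c * (v j * v j)) := by
      simp only [z, map_add, map_mul, AlgEquiv.commutes, hN]
      linear_combination algebraMap F K (v i) * algebraMap F K (v j) * hθ1
    refine ⟨Fin.cons (z 0 1) (Fin.cons (z 2 3) (Fin.cons (z 4 5) 0)), fun hx => hv ?_, ?_⟩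
    · have h01 : z 0 1 = 0 := congrFun hx 0
      have h23 : z 2 3 = 0 := congrFun hx 1
      have h45 : z 4 5 = 0 := congrFun hx 2
      obtain ⟨h0, h1⟩ := algebraMap_add_mul_eq_zero hθ h01
      obtain ⟨h2, h3⟩ := algebraMap_add_mul_eq_zero hθ h23
      obtain ⟨h4, h5⟩ := algebraMap_add_mul_eq_zero hθ h45
      ext i
      fin_cases i <;> assumption
    · have hsum : α 0 * (v 0 * v 0 + v 0 * v 1 + c * (v 1 * v 1))
          + α 1 * (v 2 * v 2 + v 2 * v 3 + c * (v 3 * v 3))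
          + α 2 * (v 4 * v 4 + v 4 * v 5 + c * (v 5 * v 5)) = 0 := by
        have h0 := hα 0
        simp only [pfister3Form, h6, h7] at hq
        have h1 : α 1 = α 0 * (α 1 / α 0) := (mul_div_cancel₀ _ h0).symm
        have h2 : α 2 = α 0 * (α 2 / α 0) := (mul_div_cancel₀ _ h0).symm
        rw [h1, h2]
        linear_combination α 0 * hq
      rw [hdef, Fin.sum_univ_succ, Fin.sum_univ_succ, Fin.sum_univ_succ]
      simp only [mul_assoc, Fin.cons_zero, Fin.cons_succ, hz, Pi.zero_apply, mul_zero,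
        Finset.sum_const_zero, add_zero, ← map_mul, ← map_add]
      rw [← add_assoc]
      exact (congrArg (algebraMap F K) hsum).trans (map_zero _)

end Triality
end

section
/- Let F be a field of characteristic 2, let (A, σ) be a central simple F-algebra with F-linear involution containing a σ-stable étale quadratic F-algebra K on which σ acts nontrivially, and let (C, σ_C) be the centralizer of K in A with the unitary involution induced by σ. Then σ is symplectic, and σ is the unique involution on A whose restriction to C is σ_C. -/
/-!  Common definitions for formalizing results of
"Triality over fields with I³ = 0" (F. K. Bingöl, A. Quéguiner-Mathieu).

We model an algebra with quadratic pair `(A, σ, f)` by the data of the reduced trace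
`T` of `A` (given together with the property `IsReducedTrace` characterising it via a
splitting field), the involution `σ`, and an element `ℓ ∈ A` with `ℓ + σ(ℓ) = 1`; the
semi-trace is `f = f_ℓ : s ↦ T(ℓ s)`.  By [KMRT, (5.7)] every semi-trace is of this
form, so this is an equivalent description of quadratic pairs.  -/

open scoped TensorProduct
open Module

namespace Triality

section SemilinearPart

variable {F A : Type*} [Field F] [Ring A] [Algebra F A]

/-- In characteristic 2, the elements `x` with `x u = (u + 1) x`; when `u² + u` is central, they
form a complement of the centralizer of `u`. -/
def semilinearPart (F : Type*) {A : Type*} [Field F] [Ring A] [Algebra F A] (u : A) :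
    Submodule F A where
  carrier := {x | u * x + x * u = x}
  add_mem' {x y} hx hy := by
    simp only [Set.mem_ofPred_eq] at *
    rw [mul_add, add_mul, add_add_add_comm, hx, hy]
  zero_mem' := by simp
  smul_mem' c x hx := by
    simp only [Set.mem_ofPred_eq] at *
    rw [mul_smul_comm, smul_mul_assoc, ← smul_add, hx]

theorem mem_semilinearPart {u x : A} : x ∈ semilinearPart F u ↔ u * x + x * u = x := Iff.rfl

variable {u : A}

theorem mul_mem_semilinearPart {c x : A} (hc : u * c = c * u) (hx : x ∈ semilinearPart F u) :
    c * x ∈ semilinearPart F u := by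
  rw [mem_semilinearPart] at *
  rw [← mul_assoc, hc, mul_assoc, mul_assoc, ← mul_add, hx]

theorem mem_semilinearPart_mul {c x : A} (hc : u * c = c * u) (hx : x ∈ semilinearPart F u) :
    x * c ∈ semilinearPart F u := by
  rw [mem_semilinearPart] at *
  rw [mul_assoc x, ← hc, ← mul_assoc, ← mul_assoc, ← add_mul, hx]

theorem eq_of_mul_eq_mul_semilinearPart (h1 : 1 ∈ semilinearPart F u * semilinearPart F u)
    {b c : A} (h : ∀ x ∈ semilinearPart F u, b * x = c * x) : b = c := by
  suffices ∀ s ∈ semilinearPart F u * semilinearPart F u, b * s = c * s by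
    simpa using this 1 h1
  intro s hs
  induction hs using Submodule.mul_induction_on' with
  | mem_mul_mem x hx y hy => rw [← mul_assoc, ← mul_assoc, h x hx]
  | add x _ y _ hx hy => rw [mul_add, mul_add, hx, hy]

theorem mul_mem_semilinearPart_mul {c s : A} (hc : u * c = c * u)
    (hs : s ∈ semilinearPart F u * semilinearPart F u) :
    c * s ∈ semilinearPart F u * semilinearPart F u := by
  induction hs using Submodule.mul_induction_on' with
  | mem_mul_mem x hx y hy =>
    rw [← mul_assoc]
    exact Submodule.mul_mem_mul (mul_mem_semilinearPart hc hx) hy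
  | add x _ y _ hx hy => rw [mul_add]; exact add_mem hx hy

theorem semilinearPart_mul_mem_mul {c s : A} (hc : u * c = c * u)
    (hs : s ∈ semilinearPart F u * semilinearPart F u) :
    s * c ∈ semilinearPart F u * semilinearPart F u := by
  induction hs using Submodule.mul_induction_on' with
  | mem_mul_mem x hx y hy =>
    rw [mul_assoc]
    exact Submodule.mul_mem_mul hx (mem_semilinearPart_mul hc hy)
  | add x _ y _ hx hy => rw [add_mul]; exact add_mem hx hy

variable [CharP A 2]

theorem commute_mul_of_mem_semilinearPart {x y : A} (hx : x ∈ semilinearPart F u)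
    (hy : y ∈ semilinearPart F u) : u * (x * y) = (x * y) * u := by
  have e1 : (u * x + x * u) * y = x * y := by rw [mem_semilinearPart.1 hx]
  have e2 : x * (u * y + y * u) = x * y := by rw [mem_semilinearPart.1 hy]
  linear_combination (norm := grind only) e1 - e2

theorem bracket_mem_semilinearPart {a : F} (hu : u * u = u + algebraMap F A a) (x : A) :
    u * x + x * u ∈ semilinearPart F u := by
  have h := Algebra.commutes a x
  have e1 : u * u * x = (u + algebraMap F A a) * x := by rw [hu]
  have e2 : x * (u * u) = x * (u + algebraMap F A a) := by rw [hu]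
  rw [mem_semilinearPart]
  linear_combination (norm := grind only) e1 + e2 + h

theorem commute_add_bracket {a : F} (hu : u * u = u + algebraMap F A a) (x : A) :
    u * (x + (u * x + x * u)) = (x + (u * x + x * u)) * u := by
  have h := Algebra.commutes a x
  have e1 : u * u * x = (u + algebraMap F A a) * x := by rw [hu]
  have e2 : x * (u * u) = x * (u + algebraMap F A a) := by rw [hu]
  linear_combination (norm := grind only) e1 + e2 + h

/-- The two-sided ideal of elements whose component in the centralizer of `u` is a sum of
products of two elements of the semilinear part. -/
def semilinearIdeal {a : F} (hu : u * u = u + algebraMap F A a) : TwoSidedIdeal A :=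
  .mk' {z | z + (u * z + z * u) ∈ semilinearPart F u * semilinearPart F u}
    (by simp)
    (fun {x y} hx hy => by
      have h : x + y + (u * (x + y) + (x + y) * u) =
        (x + (u * x + x * u)) + (y + (u * y + y * u)) := by grind
      rw [Set.mem_ofPred_eq, h]
      exact add_mem hx hy)
    (fun {x} hx => by
      have h : -x + (u * -x + -x * u) = -(x + (u * x + x * u)) := by grind
      rw [Set.mem_ofPred_eq, h]
      exact neg_mem hx)
    (fun {x y} hy => by
      have h : x * y + (u * (x * y) + x * y * u) =
        (x + (u * x + x * u)) * (y + (u * y + y * u)) + (u * x + x * u) * (u * y + y * u) := by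
        grind
      rw [Set.mem_ofPred_eq, h]
      exact add_mem (mul_mem_semilinearPart_mul (commute_add_bracket hu x) hy)
        (Submodule.mul_mem_mul (bracket_mem_semilinearPart hu x) (bracket_mem_semilinearPart hu y)))
    (fun {x y} hx => by
      have h : x * y + (u * (x * y) + x * y * u) =
        (x + (u * x + x * u)) * (y + (u * y + y * u)) + (u * x + x * u) * (u * y + y * u) := by
        grind
      rw [Set.mem_ofPred_eq, h]
      exact add_mem (semilinearPart_mul_mem_mul (commute_add_bracket hu y) hx)
        (Submodule.mul_mem_mul (bracket_mem_semilinearPart hu x) (bracket_mem_semilinearPart hu y)))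

theorem mem_semilinearIdeal {a : F} (hu : u * u = u + algebraMap F A a) {z : A} :
    z ∈ semilinearIdeal hu ↔
      z + (u * z + z * u) ∈ semilinearPart F u * semilinearPart F u := by
  rw [semilinearIdeal, TwoSidedIdeal.mem_mk']
  rfl

theorem one_mem_semilinearPart_mul [Algebra.IsCentral F A] [IsSimpleRing A] {a : F}
    (hu : u * u = u + algebraMap F A a) (hugen : u ∉ Set.range (algebraMap F A)) :
    1 ∈ semilinearPart F u * semilinearPart F u := by
  have hle : ∀ x ∈ semilinearPart F u, x ∈ semilinearIdeal hu := fun x hx => by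
    rw [mem_semilinearIdeal, mem_semilinearPart.1 hx, CharTwo.add_self_eq_zero]
    exact zero_mem _
  rcases eq_bot_or_eq_top (semilinearIdeal hu) with h | h
  · refine absurd ?_ hugen
    have hc : u ∈ Subalgebra.center F A := by
      rw [Subalgebra.mem_center_iff]
      intro x
      have := hle _ (bracket_mem_semilinearPart hu x)
      rw [h, TwoSidedIdeal.mem_bot] at this
      exact (CharTwo.add_eq_zero.1 this).symm
    exact Algebra.mem_bot.1 (Algebra.IsCentral.out hc)
  · have : (1 : A) ∈ semilinearIdeal hu := h ▸ trivial
    rwa [mem_semilinearIdeal, mul_one, one_mul, CharTwo.add_self_eq_zero, add_zero] at this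

/-- A right module endomorphism of the semilinear part over the centralizer of `u` is a left
multiplication by an element of that centralizer. -/
theorem exists_eq_mul_of_one_mem (h1 : 1 ∈ semilinearPart F u * semilinearPart F u)
    (ψ : A →ₗ[F] A) (hmem : ∀ x ∈ semilinearPart F u, ψ x ∈ semilinearPart F u)
    (hψ : ∀ x ∈ semilinearPart F u, ∀ c, u * c = c * u → ψ (x * c) = ψ x * c) :
    ∃ g, u * g = g * u ∧ ∀ x ∈ semilinearPart F u, ψ x = g * x := by
  suffices ∀ s ∈ semilinearPart F u * semilinearPart F u,
      ∃ g, u * g = g * u ∧ ∀ x ∈ semilinearPart F u, ψ (s * x) = g * x by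
    simpa using this 1 h1
  intro s hs
  induction hs using Submodule.mul_induction_on' with
  | mem_mul_mem x hx y hy =>
    refine ⟨ψ x * y, commute_mul_of_mem_semilinearPart (hmem x hx) hy, fun z hz => ?_⟩
    rw [mul_assoc, mul_assoc, hψ x hx _ (commute_mul_of_mem_semilinearPart hy hz)]
  | add x _ y _ hx hy =>
    obtain ⟨g, hg, hgx⟩ := hx
    obtain ⟨k, hk, hky⟩ := hy
    refine ⟨g + k, by rw [mul_add, add_mul, hg, hk], fun z hz => ?_⟩
    rw [add_mul, map_add, hgx z hz, hky z hz, add_mul]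

/-- Conjugation by the semilinear part sends an element `z` of the centre of the centralizer of
`u` to an element `w` of that centralizer with `z + w` in `F`. -/
theorem exists_conj_of_center [Algebra.IsCentral F A] {a : F}
    (hu : u * u = u + algebraMap F A a)
    (h1 : 1 ∈ semilinearPart F u * semilinearPart F u) {z : A} (hzu : u * z = z * u)
    (hz : ∀ c, u * c = c * u → z * c = c * z) :
    ∃ (w : A) (t : F), u * w = w * u ∧ (∀ x ∈ semilinearPart F u, x * z = w * x) ∧
      z + w = algebraMap F A t := by
  obtain ⟨w, hw, hwx⟩ := exists_eq_mul_of_one_mem h1 (LinearMap.mulRight F z)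
    (fun x hx => mem_semilinearPart_mul hzu hx)
    (fun x _ c hc => by simp only [LinearMap.mulRight_apply, mul_assoc, hz c hc])
  simp only [LinearMap.mulRight_apply] at hwx
  have hwc : ∀ c, u * c = c * u → w * c = c * w := fun c hc =>
    eq_of_mul_eq_mul_semilinearPart h1 fun x hx => by
      rw [mul_assoc, mul_assoc, ← hwx _ (mul_mem_semilinearPart hc hx), ← hwx x hx, mul_assoc]
  have hwz : ∀ x ∈ semilinearPart F u, x * w = z * x := fun x hx =>
    eq_of_mul_eq_mul_semilinearPart h1 fun y hy => by
      rw [mul_assoc, ← hwx y hy, ← mul_assoc, mul_assoc z,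
        hz _ (commute_mul_of_mem_semilinearPart hx hy)]
  have hcen : z + w ∈ Subalgebra.center F A := by
    rw [Subalgebra.mem_center_iff]
    intro x
    have h := bracket_mem_semilinearPart hu x
    have e1 := hwx _ h
    have e2 := hwz _ h
    have e3 := hz _ (commute_add_bracket hu x)
    have e4 := hwc _ (commute_add_bracket hu x)
    clear hz hwc
    linear_combination (norm := grind only) e1 + e2 + e3 + e4
  obtain ⟨t, ht⟩ := Algebra.mem_bot.1 (Algebra.IsCentral.out hcen)
  exact ⟨w, t, hw, hwx, ht.symm⟩

/-- The centre of the centralizer of `u` is `F[u]`. -/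
theorem exists_eq_of_center [Algebra.IsCentral F A] {a : F}
    (hu : u * u = u + algebraMap F A a)
    (h1 : 1 ∈ semilinearPart F u * semilinearPart F u) {z : A} (hzu : u * z = z * u)
    (hz : ∀ c, u * c = c * u → z * c = c * z) :
    ∃ p q : F, z = algebraMap F A p + algebraMap F A q * u := by
  obtain ⟨w, t, hw, hwx, ht⟩ := exists_conj_of_center hu h1 hzu hz
  obtain ⟨v, s, -, hvx, hs⟩ := exists_conj_of_center hu h1 (z := u * z)
    (by rw [mul_assoc, ← hzu])
    (fun c hc => by rw [mul_assoc, hz c hc, ← mul_assoc, hc, mul_assoc])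
  have hvw : v = (u + 1) * w := eq_of_mul_eq_mul_semilinearPart h1 fun x hx => by
    have e1 : u * (x * z) = u * (w * x) := by rw [hwx x hx]
    have e2 : (u * x + x * u) * z = x * z := by rw [mem_semilinearPart.1 hx]
    have e3 := hvx x hx
    have e4 := hwx x hx
    clear hz
    linear_combination (norm := grind only) e1 + e2 + e3 + e4
  have htu : (z + w) * u = algebraMap F A t * u := by rw [ht]
  refine ⟨s + t, t, ?_⟩
  rw [map_add]
  clear hz
  linear_combination (norm := grind only) hs + ht + htu + hvw + hw + hzu

theorem eq_one_of_mul_self_eq_one [Nontrivial A] [CharP F 2] {a p q : F}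
    (hu : u * u = u + algebraMap F A a) (hugen : u ∉ Set.range (algebraMap F A)) {g : A}
    (hg : g = algebraMap F A p + algebraMap F A q * u) (hgg : g * g = 1) : g = 1 := by
  have hsq : algebraMap F A (q * q) * u = algebraMap F A (1 + p * p + q * q * a) := by
    have e1 := Algebra.commutes q u
    have e2 : algebraMap F A q * (algebraMap F A q * (u * u)) =
      algebraMap F A q * (algebraMap F A q * (u + algebraMap F A a)) := by rw [hu]
    have e3 : algebraMap F A q * (algebraMap F A q * u) * u =
      algebraMap F A q * (u * algebraMap F A q) * u := by rw [e1]
    have e4 : algebraMap F A p * (algebraMap F A q * u) =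
      algebraMap F A q * u * algebraMap F A p := by
      rw [← mul_assoc, ← map_mul, mul_comm, map_mul, mul_assoc, mul_assoc, Algebra.commutes p u]
    rw [hg] at hgg
    simp only [map_add, map_mul, map_one]
    linear_combination (norm := grind only) hgg + e2 + e3 + e4
  have hq : q = 0 := by
    by_contra hq
    refine hugen ⟨(q * q)⁻¹ * (1 + p * p + q * q * a), ?_⟩
    rw [map_mul, ← hsq, ← mul_assoc, ← map_mul, inv_mul_cancel₀ (mul_ne_zero hq hq), map_one,
      one_mul]
  rw [hq, map_zero, zero_mul, add_zero] at hg
  rw [hg, ← map_mul, ← map_one (algebraMap F A)] at hgg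
  have hp := (algebraMap F A).injective hgg
  have hp1 : (p + 1) * (p + 1) = 0 := by grind
  rw [hg, CharTwo.add_eq_zero.1 (mul_self_eq_zero.1 hp1), map_one]

/-- An involution sending `u` to `1 - u` is determined by its restriction to the centralizer
of `u`. -/
theorem eq_of_eqOn_centralizer [CharP F 2] [Algebra.IsCentral F A] [IsSimpleRing A] {a : F}
    (hu : u * u = u + algebraMap F A a) (hugen : u ∉ Set.range (algebraMap F A))
    {σ τ : A →ₗ[F] A} (hσ : ∀ x y, σ (x * y) = σ y * σ x) (hσσ : ∀ x, σ (σ x) = x)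
    (hτ : ∀ x y, τ (x * y) = τ y * τ x) (hττ : ∀ x, τ (τ x) = x) (hσu : σ u = 1 - u)
    (h : ∀ c, u * c = c * u → τ c = σ c) : τ = σ := by
  have h1 := one_mem_semilinearPart_mul hu hugen
  have hσC : ∀ c, u * c = c * u → u * σ c = σ c * u := fun c hc => by
    have := congrArg σ hc
    rw [hσ, hσ, hσu] at this
    clear h
    linear_combination (norm := grind only) this
  have hσ1 : σ 1 = 1 := by
    have := hσ (σ 1) 1
    rwa [mul_one, hσσ, mul_one, eq_comm] at this
  have hσN : ∀ x ∈ semilinearPart F u, σ x ∈ semilinearPart F u := fun x hx => by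
    have := congrArg σ (mem_semilinearPart.1 hx)
    rw [map_add, hσ, hσ, hσu] at this
    rw [mem_semilinearPart]
    clear h hσC
    linear_combination (norm := grind only) this
  have hτN : ∀ x ∈ semilinearPart F u, τ x ∈ semilinearPart F u := fun x hx => by
    have := congrArg τ (mem_semilinearPart.1 hx)
    rw [map_add, hτ, hτ, h u rfl, hσu] at this
    rw [mem_semilinearPart]
    clear h hσC
    linear_combination (norm := grind only) this
  obtain ⟨g, hgu, hg⟩ := exists_eq_mul_of_one_mem h1 (τ ∘ₗ σ) (fun x hx => hτN _ (hσN x hx))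
    (fun x hx c hc => by
      simp only [LinearMap.comp_apply]
      rw [hσ, hτ, h _ (hσC c hc), hσσ])
  simp only [LinearMap.comp_apply] at hg
  have hgC : ∀ c, u * c = c * u → g * c = c * g := fun c hc =>
    eq_of_mul_eq_mul_semilinearPart h1 fun x hx => by
      rw [mul_assoc, mul_assoc, ← hg _ (mul_mem_semilinearPart hc hx), ← hg x hx, hσ, hτ,
        h _ (hσC c hc), hσσ]
  obtain ⟨p, q, hpq⟩ := exists_eq_of_center hu h1 hgu hgC
  have hσg : ∀ x ∈ semilinearPart F u, x * σ g = g * x := fun x hx => by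
    have e : (u * x + x * u) = x := hx
    have c1 := Algebra.commutes p x
    have c2 := Algebra.commutes q x
    have e1 : algebraMap F A q * (u * x + x * u) = algebraMap F A q * x := by rw [e]
    have e2 : x * algebraMap F A q * u = algebraMap F A q * x * u := by rw [c2]
    have : σ g = algebraMap F A p + algebraMap F A q * (1 - u) := by
      rw [hpq, map_add, ← Algebra.smul_def, map_smul, hσu, Algebra.smul_def,
        Algebra.algebraMap_eq_smul_one, map_smul, hσ1]
    rw [this, hpq]
    clear h hσC hgC hσσ hττ
    linear_combination (norm := grind only) c1 + c2 + e1 + e2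
  have hτg : ∀ x ∈ semilinearPart F u, τ x = g * σ x := fun x hx => by
    rw [← hg _ (hσN x hx), hσσ]
  have hgg : g * g = 1 := eq_of_mul_eq_mul_semilinearPart h1 fun x hx => by
    rw [one_mul, mul_assoc, ← hσg x hx]
    have := hττ x
    rw [hτg x hx, hτ, h g hgu, hτg _ (hσN x hx), hσσ, mul_assoc, hσg x hx] at this
    rw [hσg x hx]
    exact this
  have hg1 := eq_one_of_mul_self_eq_one hu hugen hpq hgg
  ext x
  have hc := h _ (commute_add_bracket hu x)
  have hd := hτg _ (bracket_mem_semilinearPart hu x)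
  rw [hg1, one_mul] at hd
  rw [map_add τ x, map_add σ x, hd] at hc
  exact add_right_cancel hc

end SemilinearPart

/-- Let `F` be a field of characteristic 2, `(A, σ)` a central
simple `F`-algebra with `F`-linear involution containing a `σ`-stable étale quadratic
`F`-algebra `K = F[u]` (`u² = u + a`) on which `σ` acts nontrivially (`σ u = 1 - u`),
and let `(C, σ_C)` be the centralizer of `K` in `A` with the unitary involution induced
by `σ`.  Then `σ` is symplectic (`1` is alternating), and `σ` is the unique involution
on `A` whose restriction to `C` is `σ_C`. -/
theorem char_two_symplectic_unique (F : Type) [Field F] (hchar : ringChar F = 2)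
    (A : Type) [Ring A] [Algebra F A] (hA : IsCSA F A)
    (σ : A →ₗ[F] A) (hσ : IsInvolution F σ)
    (u : A) (a : F) (hu : u * u = u + algebraMap F A a)
    (hugen : u ∉ Set.range (algebraMap F A))
    (hσu : σ u = 1 - u) :
    (∃ y : A, (1 : A) = y + σ y) ∧
    ∀ τ : A →ₗ[F] A, IsInvolution F τ →
      (∀ x ∈ Subalgebra.centralizer F ({u} : Set A), τ x = σ x) → τ = σ := by
  refine ⟨⟨u, by rw [hσu, add_sub_cancel]⟩, fun τ hτ h => ?_⟩
  obtain ⟨_, _, _⟩ := hA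
  have : CharP F 2 := hchar ▸ ringChar.charP F
  have : CharP A 2 := charP_of_injective_algebraMap' F 2
  refine eq_of_eqOn_centralizer hu hugen hσ.1 hσ.2 hτ.1 hτ.2 hσu fun c hc => h c ?_
  rw [Subalgebra.mem_centralizer_iff]
  rintro _ rfl
  exact hc

end Triality
end
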